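/- Let Ω⁺ ⊂ ℝ³ be a bounded open set with Lipschitz boundary, let φ be the potential of the minimizer of the unconstrained problem, and let Ω₀ := ℝ³ \ closure({φ > 0}). Then φ is of class C^{1,1} locally in ℝ³ \ closure(Ω⁺) (i.e., φ is differentiable there with locally Lipschitz gradient), and the boundary ∂Ω₀ has locally finite 2-dimensional Hausdorff measure in ℝ³ \ closure(Ω⁺): for every compact K ⊂ ℝ³ \ closure(Ω⁺), ℋ²(∂Ω₀ ∩ K) < ∞. -/

import Mathlib

open MeasureTheory Real
open scoped RealInnerProductSpace

noncomputable section

abbrev E3 := EuclideanSpace ℝ (Fin 3)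

/-- The Coulomb kernel in ℝ³. -/
def coul (x y : E3) : ℝ := 1 / (4 * π * ‖x - y‖)

/-- The Coulomb energy `E(Ω⁻)`. -/
def energy (Ωp Ωm : Set E3) : ℝ :=
  (∫ x in Ωp, ∫ y in Ωp, coul x y) + (∫ x in Ωm, ∫ y in Ωm, coul x y)
    - 2 * ∫ x in Ωp, ∫ y in Ωm, coul x y

/-- Admissible configurations for the unconstrained problem. -/
def Adm (Ωp Ωm : Set E3) : Prop :=
  MeasurableSet Ωm ∧ volume (Ωp ∩ Ωm) = 0 ∧ volume Ωm < ⊤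

/-- The potential `φ` generated by the charges `χ_{Ω⁺} − χ_{Ω⁻}`. -/
def potential (Ωp Ωm : Set E3) (x : E3) : ℝ :=
  ∫ y, (Set.indicator Ωp (fun _ => (1:ℝ)) y - Set.indicator Ωm (fun _ => (1:ℝ)) y) * coul x y

/-- A bounded open set has Lipschitz boundary if near each boundary point, after
choosing a unit direction `ν`, the set is the region above the graph of a
Lipschitz function over the hyperplane orthogonal to `ν`. -/
def HasLipschitzBoundary (Ω : Set E3) : Prop :=
  ∀ x ∈ frontier Ω, ∃ (ν : E3) (ψ : E3 → ℝ) (K : NNReal) (r : ℝ),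
    ‖ν‖ = 1 ∧ LipschitzWith K ψ ∧ 0 < r ∧
    ∀ (v : E3) (t : ℝ), ⟪v, ν⟫ = 0 → x + v + t • ν ∈ Metric.ball x r →
      (x + v + t • ν ∈ Ω ↔ ψ v < t)

lemma measurePreserving_coords : MeasurePreserving (fun z : E3 => (z 0, (z 1, z 2))) volume
    (volume : Measure (ℝ × ℝ × ℝ)) := by
  have h1 : MeasurePreserving (fun z : E3 => (fun i => z i)) volume volume :=
    PiLp.volume_preserving_ofLp (Fin 3)
  have h2 := volume_preserving_piFinSuccAbove (fun _ : Fin 3 => ℝ) 0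
  have h3 := volume_preserving_finTwoArrow ℝ
  have h4 := (MeasurePreserving.id (volume : Measure ℝ)).prod h3
  exact (h4.comp h2).comp h1

lemma integral_radial_disc {k : ℝ} (hk : k ≠ 0) (s : ℝ) :
    ∫ R in (0:ℝ)..s, R * (√(k ^ 2 + R ^ 2))⁻¹ = √(k ^ 2 + s ^ 2) - |k| := by
  have hpos : ∀ R : ℝ, 0 < k ^ 2 + R ^ 2 := fun R => by positivity
  rw [intervalIntegral.integral_eq_sub_of_hasDerivAt (f := fun R => √(k ^ 2 + R ^ 2))]
  · simp [Real.sqrt_sq_eq_abs]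
  · intro R _
    have := ((hasDerivAt_pow 2 R).const_add (k ^ 2)).sqrt (hpos R).ne'
    refine this.congr_deriv ?_
    have h := (Real.sqrt_pos.2 (hpos R)).ne'
    rw [← div_eq_mul_inv]
    field_simp
    simp
  · apply Continuous.intervalIntegrable
    exact continuous_id.mul (Continuous.inv₀ (by fun_prop) fun R => (Real.sqrt_pos.2 (hpos R)).ne')

lemma lintegral_radial_disc {k s : ℝ} (hk : k ≠ 0) (hs : 0 ≤ s) :
    ∫⁻ R in Set.Ioc 0 s, ENNReal.ofReal (R * (√(k ^ 2 + R ^ 2))⁻¹)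
      = ENNReal.ofReal (√(k ^ 2 + s ^ 2) - |k|) := by
  have hpos : ∀ R : ℝ, 0 < k ^ 2 + R ^ 2 := fun R => by positivity
  have hint : IntervalIntegrable (fun R => R * (√(k ^ 2 + R ^ 2))⁻¹) volume 0 s := by
    apply Continuous.intervalIntegrable
    exact continuous_id.mul (Continuous.inv₀ (by fun_prop) fun R => (Real.sqrt_pos.2 (hpos R)).ne')
  rw [← integral_radial_disc hk s, intervalIntegral.integral_of_le hs,
    ofReal_integral_eq_lintegral_ofReal]
  · exact (intervalIntegrable_iff_integrableOn_Ioc_of_le hs).1 hint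
  · filter_upwards [ae_restrict_mem measurableSet_Ioc] with R hR
    have := hR.1
    positivity

/-- The integral over a horizontal slice of the unit ball, at height `t`, of the Coulomb kernel
with pole at height `a` on the axis. -/
lemma lintegral_slice {a t : ℝ} (hat : t ≠ a) :
    ∫⁻ q : ℝ × ℝ, (if t ^ 2 + q.1 ^ 2 + q.2 ^ 2 ≤ 1 then
      ENNReal.ofReal (√((t - a) ^ 2 + q.1 ^ 2 + q.2 ^ 2))⁻¹ else 0)
    = if t ^ 2 ≤ 1 then ENNReal.ofReal (2 * π * (√(1 - 2 * a * t + a ^ 2) - |t - a|)) else 0 := by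
  have hk : t - a ≠ 0 := sub_ne_zero.2 hat
  rw [← lintegral_comp_polarCoord_symm]
  have hcs : ∀ p : ℝ × ℝ, (p.1 * cos p.2) ^ 2 + (p.1 * sin p.2) ^ 2 = p.1 ^ 2 := fun p => by
    have := Real.sin_sq_add_cos_sq p.2
    linear_combination p.1 ^ 2 * this
  simp only [polarCoord_symm_apply, add_assoc, hcs]
  rw [polarCoord_target, Measure.volume_eq_prod, setLIntegral_prod]
  swap
  · apply Measurable.aemeasurable
    simp only [smul_eq_mul]
    refine Measurable.mul (by fun_prop) ?_
    exact Measurable.ite (measurableSet_le (by fun_prop) (by fun_prop)) (by fun_prop) (by fun_prop)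
  simp only [lintegral_const, Measure.restrict_apply_univ, Real.volume_Ioo, sub_neg_eq_add]
  split_ifs with h1
  · have hs : 0 ≤ √(1 - t ^ 2) := Real.sqrt_nonneg _
    have key : ∀ R ∈ Set.Ioi (0:ℝ), ENNReal.ofReal R • (if t ^ 2 + R ^ 2 ≤ 1 then
        ENNReal.ofReal (√((t - a) ^ 2 + R ^ 2))⁻¹ else 0) * ENNReal.ofReal (π + π)
        = (Set.Ioc 0 √(1 - t ^ 2)).indicator (fun R => ENNReal.ofReal (2 * π) *
          ENNReal.ofReal (R * (√((t - a) ^ 2 + R ^ 2))⁻¹)) R := by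
      intro R hR
      have hR' : 0 < R := hR
      by_cases h : t ^ 2 + R ^ 2 ≤ 1
      · have hm : R ∈ Set.Ioc 0 √(1 - t ^ 2) :=
          ⟨hR, Real.le_sqrt_of_sq_le (by linarith)⟩
        rw [if_pos h, Set.indicator_of_mem hm, smul_eq_mul, ENNReal.ofReal_mul hR'.le, two_mul,
          mul_comm]
      · have hm : R ∉ Set.Ioc 0 √(1 - t ^ 2) := by
          rintro ⟨-, h2⟩
          apply h
          have := (Real.le_sqrt' hR').1 h2
          linarith
        rw [if_neg h, Set.indicator_of_notMem hm]
        simp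
    rw [setLIntegral_congr_fun measurableSet_Ioi key, setLIntegral_indicator measurableSet_Ioc,
      Set.inter_eq_left.2 Set.Ioc_subset_Ioi_self, lintegral_const_mul _ (by fun_prop),
      lintegral_radial_disc hk hs, ← ENNReal.ofReal_mul (by positivity), Real.sq_sqrt (by linarith)]
    congr 4
    ring_nf
  · rw [setLIntegral_congr_fun (g := fun _ => 0) measurableSet_Ioi]
    · simp
    · intro R hR
      simp only
      rw [if_neg]
      · simp
      · intro h
        nlinarith [sq_nonneg R]

lemma norm_sub_smul_single_sq (z : E3) (a : ℝ) :
    ‖z - a • EuclideanSpace.single 0 1‖ = √((z 0 - a) ^ 2 + z 1 ^ 2 + z 2 ^ 2) := by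
  rw [EuclideanSpace.norm_eq]
  simp [Fin.sum_univ_three]

lemma lintegral_unitBall_axis (a : ℝ) :
    ∫⁻ z in Metric.closedBall (0:E3) 1, ENNReal.ofReal ‖z - a • EuclideanSpace.single 0 1‖⁻¹
    = ∫⁻ t in Set.Icc (-1:ℝ) 1, ENNReal.ofReal (2 * π * (√(1 - 2 * a * t + a ^ 2) - |t - a|)) := by
  let F : ℝ × ℝ × ℝ → ENNReal := fun p => if p.1 ^ 2 + p.2.1 ^ 2 + p.2.2 ^ 2 ≤ 1 then
      ENNReal.ofReal (√((p.1 - a) ^ 2 + p.2.1 ^ 2 + p.2.2 ^ 2))⁻¹ else 0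
  have hF : Measurable F :=
    Measurable.ite (measurableSet_le (by fun_prop) (by fun_prop)) (by fun_prop) (by fun_prop)
  rw [← lintegral_indicator Metric.isClosed_closedBall.measurableSet]
  have h1 : ∀ z : E3, (Metric.closedBall (0:E3) 1).indicator
      (fun z => ENNReal.ofReal ‖z - a • EuclideanSpace.single 0 1‖⁻¹) z
      = F (z 0, (z 1, z 2)) := by
    intro z
    have hz : z ∈ Metric.closedBall (0:E3) 1 ↔ z 0 ^ 2 + z 1 ^ 2 + z 2 ^ 2 ≤ 1 := by
      rw [mem_closedBall_zero_iff, EuclideanSpace.norm_eq, Real.sqrt_le_one]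
      simp [Fin.sum_univ_three]
    by_cases h : z ∈ Metric.closedBall (0:E3) 1
    · simp only [Set.indicator_of_mem h, F, if_pos (hz.1 h), norm_sub_smul_single_sq]
    · simp only [Set.indicator_of_notMem h, F, if_neg (fun h' => h (hz.2 h'))]
  rw [lintegral_congr h1, measurePreserving_coords.lintegral_comp hF, Measure.volume_eq_prod,
    lintegral_prod _ hF.aemeasurable, ← lintegral_indicator measurableSet_Icc]
  apply lintegral_congr_ae
  have : ∀ᵐ t : ℝ, t ≠ a := by simp [ae_iff]
  filter_upwards [this] with t ht
  simp only [F]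
  rw [lintegral_slice ht]
  have hm : t ^ 2 ≤ 1 ↔ t ∈ Set.Icc (-1:ℝ) 1 := by
    rw [sq_le_one_iff_abs_le_one, abs_le]; rfl
  by_cases h : t ∈ Set.Icc (-1:ℝ) 1
  · rw [Set.indicator_of_mem h, if_pos (hm.2 h)]
  · rw [Set.indicator_of_notMem h, if_neg (fun h' => h (hm.1 h'))]

lemma integral_sqrt_chord {a : ℝ} (ha : 0 < a) :
    ∫ t in (-1:ℝ)..1, √(1 - 2 * a * t + a ^ 2) = ((1 + a) ^ 3 - |1 - a| ^ 3) / (3 * a) := by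
  have hX : ∀ t : ℝ, t < 1 → 0 < 1 - 2 * a * t + a ^ 2 := fun t ht => by
    nlinarith [sq_nonneg (1 - a), mul_pos ha (sub_pos.2 ht)]
  rw [intervalIntegral.integral_eq_sub_of_hasDerivAt_of_le (by norm_num)
    (f := fun t => -(√(1 - 2 * a * t + a ^ 2)) ^ 3 / (3 * a))]
  · have h1 : 1 - 2 * a * 1 + a ^ 2 = (1 - a) ^ 2 := by ring
    have h2 : 1 - 2 * a * (-1) + a ^ 2 = (1 + a) ^ 2 := by ring
    simp only [h1, h2, Real.sqrt_sq_eq_abs, abs_of_pos (show 0 < 1 + a by linarith)]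
    ring
  · fun_prop
  · intro t ht
    have h0 := hX t ht.2
    have hd : HasDerivAt (fun t : ℝ => 1 - 2 * a * t + a ^ 2) (-(2 * a)) t := by
      have := (((hasDerivAt_id t).const_mul (2 * a)).const_sub 1).add_const (a ^ 2)
      simpa using this
    have h1 := (((hd.sqrt h0.ne').fun_pow 3).neg).div_const (3 * a)
    refine h1.congr_deriv ?_
    have hs := (Real.sqrt_pos.2 h0).ne'
    push_cast
    field_simp
  · apply Continuous.intervalIntegrable
    fun_prop

lemma integral_abs_sub_of_le_one {a : ℝ} (ha : 0 ≤ a) (ha1 : a ≤ 1) :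
    ∫ t in (-1:ℝ)..1, |t - a| = 1 + a ^ 2 := by
  have hc : Continuous fun t : ℝ => |t - a| := by fun_prop
  rw [← intervalIntegral.integral_add_adjacent_intervals (b := a)
    (hc.intervalIntegrable _ _) (hc.intervalIntegrable _ _)]
  have h1 : ∫ t in (-1:ℝ)..a, |t - a| = ∫ t in (-1:ℝ)..a, (a - t) := by
    apply intervalIntegral.integral_congr
    intro t ht
    rw [Set.uIcc_of_le (by linarith)] at ht
    simp only
    rw [abs_of_nonpos (by linarith [ht.2])]; ring
  have h2 : ∫ t in a..1, |t - a| = ∫ t in a..1, (t - a) := by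
    apply intervalIntegral.integral_congr
    intro t ht
    rw [Set.uIcc_of_le (by linarith)] at ht
    simp only
    rw [abs_of_nonneg (by linarith [ht.1])]
  rw [h1, h2, intervalIntegral.integral_sub (by simp) (by simp),
    intervalIntegral.integral_sub (by simp) (by simp)]
  simp
  ring

lemma integral_abs_sub_of_one_le {a : ℝ} (ha1 : 1 ≤ a) :
    ∫ t in (-1:ℝ)..1, |t - a| = 2 * a := by
  have h1 : ∫ t in (-1:ℝ)..1, |t - a| = ∫ t in (-1:ℝ)..1, (a - t) := by
    apply intervalIntegral.integral_congr
    intro t ht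
    rw [Set.uIcc_of_le (by linarith)] at ht
    simp only
    rw [abs_of_nonpos (by linarith [ht.2])]; ring
  rw [h1, intervalIntegral.integral_sub (by simp) (by simp)]
  simp only [intervalIntegral.integral_const, integral_id, smul_eq_mul]
  ring

/-- The Newtonian potential (without normalisation) of the unit ball, as a function of the distance
to the centre. -/
def ballPot (a : ℝ) : ℝ := if a ≤ 1 then 2 * π * (1 - a ^ 2 / 3) else 4 * π / (3 * a)

lemma integral_chord {a : ℝ} (ha : 0 ≤ a) :
    ∫ t in (-1:ℝ)..1, 2 * π * (√(1 - 2 * a * t + a ^ 2) - |t - a|) = ballPot a := by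
  have hc : Continuous fun t : ℝ => |t - a| := by fun_prop
  have hc' : Continuous fun t : ℝ => √(1 - 2 * a * t + a ^ 2) := by fun_prop
  rw [intervalIntegral.integral_const_mul, intervalIntegral.integral_sub
    (hc'.intervalIntegrable _ _) (hc.intervalIntegrable _ _)]
  rcases ha.eq_or_lt with rfl | ha'
  · rw [integral_abs_sub_of_le_one le_rfl zero_le_one]
    simp [ballPot]
  rw [integral_sqrt_chord ha']
  unfold ballPot
  split_ifs with h
  · rw [integral_abs_sub_of_le_one ha h, abs_of_nonneg (by linarith)]
    field_simp
    ring
  · rw [integral_abs_sub_of_one_le (by linarith), abs_of_nonpos (by linarith)]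
    field_simp
    ring

lemma abs_sub_le_sqrt_chord {a t : ℝ} (ht : t ∈ Set.Icc (-1:ℝ) 1) :
    |t - a| ≤ √(1 - 2 * a * t + a ^ 2) := by
  apply Real.abs_le_sqrt
  nlinarith [ht.1, ht.2]

lemma lintegral_unitBall_eq (w : E3) :
    ∫⁻ z in Metric.closedBall (0:E3) 1, ENNReal.ofReal ‖z - w‖⁻¹
      = ENNReal.ofReal (ballPot ‖w‖) := by
  let e : E3 := ‖w‖ • EuclideanSpace.single 0 1
  have he : ‖w‖ = ‖e‖ := by simp [e, norm_smul]
  let T := (ℝ ∙ (w - e))ᗮ.reflection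
  have hT : T w = e := Submodule.reflection_sub he
  have hmp : MeasurePreserving T volume volume := T.measurePreserving
  have h1 : ∫⁻ z in Metric.closedBall (0:E3) 1, ENNReal.ofReal ‖z - w‖⁻¹
      = ∫⁻ z in Metric.closedBall (0:E3) 1, ENNReal.ofReal ‖z - e‖⁻¹ := by
    rw [← hmp.setLIntegral_comp_preimage Metric.isClosed_closedBall.measurableSet
      (f := fun z => ENNReal.ofReal ‖z - e‖⁻¹) (by fun_prop)]
    have hpre : T ⁻¹' Metric.closedBall (0:E3) 1 = Metric.closedBall (0:E3) 1 := by
      ext z; simp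
    rw [hpre]
    congr 1
    ext z
    rw [← hT, ← map_sub, LinearIsometryEquiv.norm_map]
  rw [h1, lintegral_unitBall_axis, ← integral_chord (norm_nonneg w),
    intervalIntegral.integral_of_le (by norm_num), ← integral_Icc_eq_integral_Ioc,
    ofReal_integral_eq_lintegral_ofReal]
  · apply Continuous.integrableOn_Icc
    fun_prop
  · filter_upwards [ae_restrict_mem measurableSet_Icc] with t ht
    have := abs_sub_le_sqrt_chord (a := ‖w‖) ht
    have := sub_nonneg.2 this
    positivity

/-- The uniform probability measure on the closed unit ball. -/
def uball : Measure E3 :=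
  (volume (Metric.closedBall (0:E3) 1))⁻¹ • volume.restrict (Metric.closedBall (0:E3) 1)

lemma volume_unitBall_pos : 0 < volume (Metric.closedBall (0:E3) 1) :=
  Metric.measure_closedBall_pos _ _ one_pos

lemma volume_unitBall_ne_top : volume (Metric.closedBall (0:E3) 1) ≠ ⊤ :=
  (isCompact_closedBall _ _).measure_lt_top.ne

instance : IsProbabilityMeasure uball := by
  constructor
  simp only [uball, Measure.smul_apply, Measure.restrict_apply_univ, smul_eq_mul]
  exact ENNReal.inv_mul_cancel volume_unitBall_pos.ne' volume_unitBall_ne_top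

lemma ae_uball_norm_le : ∀ᵐ z ∂uball, ‖z‖ ≤ 1 := by
  apply Measure.ae_smul_measure
  filter_upwards [ae_restrict_mem Metric.isClosed_closedBall.measurableSet] with z hz
  simpa using hz

lemma uball_absolutelyContinuous : uball ≪ (volume : Measure E3) :=
  Measure.smul_absolutelyContinuous.trans Measure.absolutelyContinuous_restrict

lemma integrable_uball {f : E3 → ℝ} (hf : Continuous f) : Integrable f uball := by
  refine Integrable.smul_measure ?_ (ENNReal.inv_ne_top.2 volume_unitBall_pos.ne')
  exact hf.continuousOn.integrableOn_compact (isCompact_closedBall _ _)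

lemma measurePreserving_neg_uball : MeasurePreserving (fun z : E3 => -z) uball uball := by
  refine MeasurePreserving.smul_measure ?_ _
  have h := (Measure.measurePreserving_neg (volume : Measure E3)).restrict_preimage
    (s := Metric.closedBall (0:E3) 1) Metric.isClosed_closedBall.measurableSet
  have : Neg.neg ⁻¹' Metric.closedBall (0:E3) 1 = Metric.closedBall (0:E3) 1 := by
    ext z; simp
  rwa [this] at h

lemma integral_uball_neg (f : E3 → ℝ) : ∫ z, f (-z) ∂uball = ∫ z, f z ∂uball :=
  measurePreserving_neg_uball.integral_comp (MeasurableEquiv.neg E3).measurableEmbedding f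

/-- The average of `f` over the ball of radius `r` around `x`. -/
def ballAvg (r : ℝ) (f : E3 → ℝ) (x : E3) : ℝ := ∫ z, f (x + r • z) ∂uball

lemma integrable_ballAvg {f : E3 → ℝ} (hf : Continuous f) (r : ℝ) (x : E3) :
    Integrable (fun z => f (x + r • z)) uball :=
  integrable_uball (by fun_prop)

lemma add_smul_mem_closedBall {r : ℝ} (hr : 0 ≤ r) (x : E3) {z : E3} (hz : ‖z‖ ≤ 1) :
    x + r • z ∈ Metric.closedBall x r := by
  rw [mem_closedBall_iff_norm, add_sub_cancel_left, norm_smul, Real.norm_of_nonneg hr]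
  exact mul_le_of_le_one_right hr hz

lemma add_smul_mem_closedBall_iff {r : ℝ} (hr : 0 < r) (x z : E3) :
    x + r • z ∈ Metric.closedBall x r ↔ z ∈ Metric.closedBall (0:E3) 1 := by
  rw [mem_closedBall_zero_iff, mem_closedBall_iff_norm, add_sub_cancel_left, norm_smul,
    Real.norm_of_nonneg hr.le]
  exact mul_le_iff_le_one_right hr

lemma ballAvg_mono {f g : E3 → ℝ} (hf : Continuous f) (hg : Continuous g) {r : ℝ} (hr : 0 ≤ r)
    {x : E3} (h : ∀ y ∈ Metric.closedBall x r, f y ≤ g y) : ballAvg r f x ≤ ballAvg r g x := by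
  apply integral_mono_ae (integrable_ballAvg hf r x) (integrable_ballAvg hg r x)
  filter_upwards [ae_uball_norm_le] with z hz
  exact h _ (add_smul_mem_closedBall hr x hz)

lemma ballAvg_congr {f g : E3 → ℝ} {r : ℝ} (hr : 0 ≤ r)
    {x : E3} (h : ∀ y ∈ Metric.closedBall x r, f y = g y) : ballAvg r f x = ballAvg r g x := by
  apply integral_congr_ae
  filter_upwards [ae_uball_norm_le] with z hz
  exact h _ (add_smul_mem_closedBall hr x hz)

lemma ballAvg_const (r c : ℝ) (x : E3) : ballAvg r (fun _ => c) x = c := by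
  simp [ballAvg]

lemma ballAvg_add {f g : E3 → ℝ} (hf : Continuous f) (hg : Continuous g) (r : ℝ) (x : E3) :
    ballAvg r (fun y => f y + g y) x = ballAvg r f x + ballAvg r g x :=
  integral_add (integrable_ballAvg hf r x) (integrable_ballAvg hg r x)

lemma ballAvg_sub {f g : E3 → ℝ} (hf : Continuous f) (hg : Continuous g) (r : ℝ) (x : E3) :
    ballAvg r (fun y => f y - g y) x = ballAvg r f x - ballAvg r g x :=
  integral_sub (integrable_ballAvg hf r x) (integrable_ballAvg hg r x)

lemma ballAvg_const_mul (c : ℝ) (f : E3 → ℝ) (r : ℝ) (x : E3) :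
    ballAvg r (fun y => c * f y) x = c * ballAvg r f x :=
  integral_const_mul _ _

lemma ballAvg_comp_add (f : E3 → ℝ) (r : ℝ) (x h : E3) :
    ballAvg r (fun y => f (y + h)) x = ballAvg r f (x + h) := by
  simp only [ballAvg]
  congr 1; ext z; congr 1; abel

lemma continuous_ballAvg {f : E3 → ℝ} (hf : Continuous f) (r : ℝ) : Continuous (ballAvg r f) := by
  have : ballAvg r f = fun x => (volume (Metric.closedBall (0:E3) 1))⁻¹.toReal •
      ∫ z in Metric.closedBall (0:E3) 1, f (x + r • z) := by
    ext x
    simp [ballAvg, uball]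
  rw [this]
  refine Continuous.fun_const_smul ?_ _
  exact continuous_parametric_integral_of_continuous (by fun_prop) (isCompact_closedBall _ _)

/-- The second moment of the uniform measure on the unit ball. -/
def ballMoment : ℝ := ∫ z, ‖z‖ ^ 2 ∂uball

lemma ballMoment_pos : 0 < ballMoment := by
  rw [ballMoment, integral_pos_iff_support_of_nonneg (fun z => by positivity)
    (integrable_uball (by fun_prop))]
  have h1 : Function.support (fun z : E3 => ‖z‖ ^ 2) = {0}ᶜ := by
    ext z; simp
  rw [h1]
  have : uball {(0:E3)} = 0 := uball_absolutelyContinuous (measure_singleton _)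
  rw [prob_compl_eq_one_sub (measurableSet_singleton _), this]
  simp

lemma integral_uball_odd {f : E3 → ℝ} (hf : ∀ z, f (-z) = -f z) : ∫ z, f z ∂uball = 0 := by
  have h := integral_uball_neg f
  simp only [hf, integral_neg] at h
  linarith

lemma ballAvg_norm_sub_sq (r : ℝ) (a x : E3) :
    ballAvg r (fun y => ‖y - a‖ ^ 2) x = ‖x - a‖ ^ 2 + ballMoment * r ^ 2 := by
  have h1 : ∀ z : E3, ‖x + r • z - a‖ ^ 2 = (‖x - a‖ ^ 2 + 2 * r * ⟪x - a, z⟫)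
      + r ^ 2 * ‖z‖ ^ 2 := by
    intro z
    have : x + r • z - a = (x - a) + r • z := by abel
    rw [this, norm_add_sq_real, inner_smul_right, norm_smul, mul_pow, Real.norm_eq_abs, sq_abs]
    ring
  simp only [ballAvg, h1]
  rw [integral_add (integrable_uball (by fun_prop)) (integrable_uball (by fun_prop)),
    integral_add (integrable_uball (by fun_prop)) (integrable_uball (by fun_prop)),
    integral_const_mul, integral_const_mul, integral_uball_odd (f := fun z => ⟪x - a, z⟫)
      (fun z => by simp)]
  simp [ballMoment]
  ring

lemma finrank_E3 : Module.finrank ℝ E3 = 3 := by simp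

lemma ballAvg_eq_setIntegral (f : E3 → ℝ) {r : ℝ} (hr : 0 < r) (x : E3) :
    ballAvg r f x = (volume (Metric.closedBall (0:E3) 1)).toReal⁻¹ * (r ^ 3)⁻¹ *
      ∫ y in Metric.closedBall x r, f y := by
  have h1 : ∀ z, (Metric.closedBall (0:E3) 1).indicator (fun z => f (x + r • z)) z
      = (Metric.closedBall x r).indicator f (x + r • z) := by
    intro z
    have hz := add_smul_mem_closedBall_iff hr x z
    by_cases h : z ∈ Metric.closedBall (0:E3) 1
    · rw [Set.indicator_of_mem h, Set.indicator_of_mem (hz.2 h)]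
    · rw [Set.indicator_of_notMem h, Set.indicator_of_notMem (fun h' => h (hz.1 h'))]
  simp only [ballAvg, uball, integral_smul_measure, ENNReal.toReal_inv, smul_eq_mul]
  rw [← integral_indicator Metric.isClosed_closedBall.measurableSet, integral_congr_ae
    (Filter.Eventually.of_forall h1), Measure.integral_comp_smul volume
      (fun y => (Metric.closedBall x r).indicator f (x + y)) r,
    integral_add_left_eq_self (fun y => (Metric.closedBall x r).indicator f y) x,
    integral_indicator Metric.isClosed_closedBall.measurableSet, finrank_E3, smul_eq_mul,
    abs_of_pos (by positivity), mul_assoc]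

lemma ballAvg_le_ballAvg {f : E3 → ℝ} (hf : Continuous f) {r t : ℝ} (hr : 0 < r) {x y : E3}
    (hxy : dist x y ≤ t) (h0 : ∀ z ∈ Metric.closedBall y (r + t), 0 ≤ f z) :
    ballAvg r f x ≤ ((r + t) / r) ^ 3 * ballAvg (r + t) f y := by
  have ht : 0 ≤ t := dist_nonneg.trans hxy
  rw [ballAvg_eq_setIntegral f hr, ballAvg_eq_setIntegral f (by linarith : 0 < r + t)]
  have h1 : ∫ y in Metric.closedBall x r, f y ≤ ∫ y in Metric.closedBall y (r + t), f y := by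
    apply setIntegral_mono_set
    · exact hf.continuousOn.integrableOn_compact (isCompact_closedBall _ _)
    · filter_upwards [ae_restrict_mem Metric.isClosed_closedBall.measurableSet] with z hz
      exact h0 z hz
    · exact (Metric.closedBall_subset_closedBall' (by linarith)).eventuallyLE
  have h2 : ((r + t) / r) ^ 3 * ((volume (Metric.closedBall (0:E3) 1)).toReal⁻¹ *
      ((r + t) ^ 3)⁻¹ * ∫ y in Metric.closedBall y (r + t), f y)
      = (volume (Metric.closedBall (0:E3) 1)).toReal⁻¹ * (r ^ 3)⁻¹ *
      ∫ y in Metric.closedBall y (r + t), f y := by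
    have : r + t ≠ 0 := by linarith
    field_simp
  rw [h2]
  gcongr

section SecondDifferences

variable {E : Type*} [NormedAddCommGroup E] [NormedSpace ℝ E]

/-- A function whose mixed second differences at `x` are quadratically small is differentiable
at `x`. -/
lemma differentiableAt_of_second_difference {f : E → ℝ} {x : E} {δ C Λ : ℝ} (hδ : 0 < δ)
    (h2 : ∀ h k : E, ‖h‖ ≤ δ → ‖k‖ ≤ δ →
      |f (x + h + k) - f (x + h) - f (x + k) + f x| ≤ C * ‖h‖ * ‖k‖)
    (h1 : ∀ h : E, ‖h‖ ≤ δ → |f (x + h) - f x| ≤ Λ * ‖h‖) :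
    DifferentiableAt ℝ f x := by
  let a : ℕ → E → ℝ := fun n h => 2 ^ n * (f (x + ((1 / 2 : ℝ) ^ n) • h) - f x)
  have hhalf : ∀ n : ℕ, (0:ℝ) < (1 / 2) ^ n := fun n => by positivity
  have hnorm : ∀ (n : ℕ) (h : E), ‖((1 / 2 : ℝ) ^ n) • h‖ = (1 / 2) ^ n * ‖h‖ := fun n h => by
    rw [norm_smul, Real.norm_of_nonneg (hhalf n).le]
  have htwo : ∀ n : ℕ, (2:ℝ) ^ n * (1 / 2) ^ n = 1 := fun n => by
    rw [← mul_pow]; norm_num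
  have hsmall : ∀ h : E, ∀ᶠ n in Filter.atTop, ‖((1 / 2 : ℝ) ^ n) • h‖ ≤ δ := by
    intro h
    have : Filter.Tendsto (fun n : ℕ => (1 / 2 : ℝ) ^ n * ‖h‖) Filter.atTop (nhds (0 * ‖h‖)) :=
      (tendsto_pow_atTop_nhds_zero_of_lt_one (by norm_num) (by norm_num)).mul_const _
    rw [zero_mul] at this
    filter_upwards [this.eventually (ge_mem_nhds hδ)] with n hn
    rwa [hnorm]
  have hstep : ∀ (h : E), ‖h‖ ≤ δ → ∀ n, dist (a n h) (a (n + 1) h)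
      ≤ (C * ‖h‖ ^ 2) / 2 / 2 ^ n := by
    intro h hh n
    have hs : ∀ n : ℕ, ‖((1 / 2 : ℝ) ^ n) • h‖ ≤ δ := fun n => by
      rw [hnorm]
      exact (mul_le_of_le_one_left (norm_nonneg _)
        (pow_le_one₀ (by norm_num) (by norm_num))).trans hh
    have key := h2 _ _ (hs (n + 1)) (hs (n + 1))
    rw [hnorm, add_assoc, ← add_smul] at key
    have e1 : (1 / 2 : ℝ) ^ (n + 1) + (1 / 2) ^ (n + 1) = (1 / 2) ^ n := by ring
    rw [e1] at key
    rw [Real.dist_eq]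
    have e2 : a n h - a (n + 1) h = 2 ^ n * (f (x + (1 / 2 : ℝ) ^ n • h)
        - f (x + (1 / 2 : ℝ) ^ (n + 1) • h) - f (x + (1 / 2 : ℝ) ^ (n + 1) • h) + f x) := by
      simp only [a]; ring
    rw [e2, abs_mul, abs_of_pos (by positivity : (0:ℝ) < 2 ^ n)]
    refine (mul_le_mul_of_nonneg_left key (by positivity)).trans ?_
    have h3 : (0:ℝ) ≤ C * ‖h‖ ^ 2 := by
      by_contra! hneg
      have := (abs_nonneg _).trans (h2 h h hh hh)
      nlinarith
    have e3 : 2 ^ n * (C * ((1 / 2) ^ (n + 1) * ‖h‖) * ((1 / 2) ^ (n + 1) * ‖h‖))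
        = (C * ‖h‖ ^ 2) * (2 ^ n * (1 / 2) ^ n) * (1 / 2) ^ n / 4 := by ring
    have e4 : (1 / 2 : ℝ) ^ n = 1 / 2 ^ n := by rw [one_div_pow]
    rw [e3, htwo, e4]
    have h5 : 0 ≤ C * ‖h‖ ^ 2 / 2 ^ n := by positivity
    have e6 : C * ‖h‖ ^ 2 * 1 * (1 / 2 ^ n) / 4 = C * ‖h‖ ^ 2 / 2 ^ n / 4 := by ring
    have e7 : C * ‖h‖ ^ 2 / 2 / 2 ^ n = C * ‖h‖ ^ 2 / 2 ^ n / 2 := by ring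
    rw [e6, e7]
    linarith
  have hconv : ∀ h, ∃ l, Filter.Tendsto (fun n => a n h) Filter.atTop (nhds l) := by
    intro h
    obtain ⟨N, hN⟩ := (hsmall h).exists
    obtain ⟨l, hl⟩ := cauchySeq_tendsto_of_complete
      (cauchySeq_of_le_geometric_two (hstep _ hN))
    refine ⟨2 ^ N * l, ?_⟩
    rw [← Filter.tendsto_add_atTop_iff_nat N]
    refine (hl.const_mul (2 ^ N)).congr fun n => ?_
    simp only [a, smul_smul, ← pow_add]
    ring
  choose L hL using hconv
  have hquad : ∀ h, ‖h‖ ≤ δ → |f (x + h) - f x - L h| ≤ C * ‖h‖ ^ 2 := by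
    intro h hh
    have := dist_le_of_le_geometric_two_of_tendsto₀ (hstep h hh) (hL h)
    simpa [a, Real.dist_eq, sub_sub, add_comm] using this
  have hadd : ∀ h k, L (h + k) = L h + L k := by
    intro h k
    have ht : Filter.Tendsto (fun n => a n (h + k) - a n h - a n k) Filter.atTop (nhds 0) := by
      apply squeeze_zero_norm' (a := fun n : ℕ => C * ‖h‖ * ‖k‖ * (1 / 2) ^ n)
      · filter_upwards [hsmall h, hsmall k] with n hn hk
        have key := h2 _ _ hn hk
        rw [add_assoc, ← smul_add, hnorm, hnorm] at key
        have e : a n (h + k) - a n h - a n k = 2 ^ n * (f (x + (1 / 2 : ℝ) ^ n • (h + k))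
          - f (x + (1 / 2 : ℝ) ^ n • h) - f (x + (1 / 2 : ℝ) ^ n • k) + f x) := by
          simp only [a]; ring
        rw [e, norm_mul, Real.norm_eq_abs, Real.norm_eq_abs,
          abs_of_pos (by positivity : (0:ℝ) < 2 ^ n)]
        refine (mul_le_mul_of_nonneg_left key (by positivity)).trans (le_of_eq ?_)
        linear_combination (C * ‖h‖ * ‖k‖ * (1 / 2) ^ n) * htwo n
      · have := (tendsto_pow_atTop_nhds_zero_of_lt_one (r := (1 / 2 : ℝ)) (by norm_num)
          (by norm_num)).const_mul (C * ‖h‖ * ‖k‖)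
        simpa using this
    have := tendsto_nhds_unique ht (((hL (h + k)).sub (hL h)).sub (hL k))
    linarith
  have hbound : ∀ h, ‖L h‖ ≤ Λ * ‖h‖ := by
    intro h
    refine le_of_tendsto (hL h).norm ?_
    filter_upwards [hsmall h] with n hn
    have := h1 _ hn
    rw [hnorm] at this
    simp only [a]
    rw [norm_mul, Real.norm_eq_abs, Real.norm_eq_abs, abs_of_pos (by positivity : (0:ℝ) < 2 ^ n)]
    refine (mul_le_mul_of_nonneg_left this (by positivity)).trans (le_of_eq ?_)
    linear_combination (Λ * ‖h‖) * htwo n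
  let L₀ : E →+ ℝ := AddMonoidHom.mk' L hadd
  let L₁ : E →L[ℝ] ℝ := L₀.toRealLinearMap (AddMonoidHomClass.continuous_of_bound L₀ Λ hbound)
  have : HasFDerivAt f L₁ x := by
    rw [hasFDerivAt_iff_isLittleO_nhds_zero]
    have hO : (fun h => f (x + h) - f x - L₁ h) =O[nhds 0] fun h => ‖h‖ ^ 2 := by
      apply Asymptotics.IsBigO.of_bound C
      filter_upwards [Metric.closedBall_mem_nhds (0:E) hδ] with h hh
      rw [mem_closedBall_zero_iff] at hh
      rw [Real.norm_eq_abs, Real.norm_of_nonneg (by positivity)]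
      exact hquad h hh
    refine hO.trans_isLittleO ?_
    exact Asymptotics.isLittleO_norm_pow_id one_lt_two
  exact this.differentiableAt

lemma norm_fderiv_sub_le_of_second_difference {f : E → ℝ} {x k : E} {δ C : ℝ} (hδ : 0 < δ)
    (hC : 0 ≤ C)
    (h2 : ∀ h : E, ‖h‖ ≤ δ → |f (x + h + k) - f (x + h) - f (x + k) + f x| ≤ C * ‖h‖)
    (hx : DifferentiableAt ℝ f x) (hy : DifferentiableAt ℝ f (x + k)) :
    ‖fderiv ℝ f (x + k) - fderiv ℝ f x‖ ≤ C := by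
  have hd : HasFDerivAt (fun z => f (z + k) - f z) (fderiv ℝ f (x + k) - fderiv ℝ f x) x :=
    ((hasFDerivAt_comp_add_right k).2 hy.hasFDerivAt).sub hx.hasFDerivAt
  apply hd.le_of_lip' hC
  filter_upwards [Metric.closedBall_mem_nhds x hδ] with z hz
  rw [mem_closedBall_iff_norm] at hz
  have := h2 _ hz
  rw [add_sub_cancel] at this
  rw [Real.norm_eq_abs]
  convert this using 2
  ring

end SecondDifferences

/-- `f` satisfies the mean value property on all closed balls contained in `s`. -/
def MeanValue (f : E3 → ℝ) (s : Set E3) : Prop :=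
  ∀ x r, 0 < r → Metric.closedBall x r ⊆ s → ballAvg r f x = f x

lemma MeanValue.sub_le {f : E3 → ℝ} (hf : Continuous f) {p : E3} {R S : ℝ}
    (hm : MeanValue f (Metric.ball p R)) (hS : ∀ y ∈ Metric.ball p R, |f y| ≤ S)
    {x y : E3} (hx : x ∈ Metric.ball p (R / 2)) (hy : y ∈ Metric.ball p (R / 2))
    (hxy : dist x y ≤ R / 8) : f x - f y ≤ 56 * S / R * dist x y := by
  rw [Metric.mem_ball] at hx hy
  have hR : 0 < R := by linarith [dist_nonneg (x := x) (y := p)]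
  set t := dist x y with ht
  have ht0 : 0 ≤ t := dist_nonneg
  have hbx : Metric.closedBall x (R / 4) ⊆ Metric.ball p R :=
    Metric.closedBall_subset_ball' (by linarith)
  have hby : Metric.closedBall y (R / 4 + t) ⊆ Metric.ball p R :=
    Metric.closedBall_subset_ball' (by linarith)
  have hcS : Continuous fun _ : E3 => S := continuous_const
  have key := ballAvg_le_ballAvg (f := fun z => f z + S) (by fun_prop) (r := R / 4) (t := t)
    (by linarith) (x := x) (y := y) le_rfl
    (fun z hz => by linarith [neg_abs_le (f z), hS z (hby hz)])
  rw [ballAvg_add hf hcS, ballAvg_add hf hcS, ballAvg_const, ballAvg_const,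
    hm x _ (by linarith) hbx, hm y _ (by linarith) hby] at key
  have hy' : f y + S ≤ 2 * S := by
    have := hS y (Metric.mem_ball.2 (by linarith))
    linarith [le_abs_self (f y)]
  have hy0 : 0 ≤ f y + S := by
    have := hS y (Metric.mem_ball.2 (by linarith))
    linarith [neg_abs_le (f y)]
  set s := 4 * t / R with hs
  have hs0 : 0 ≤ s := by positivity
  have hs1 : s ≤ 1 := by
    rw [hs, div_le_one hR]; linarith
  have e1 : (R / 4 + t) / (R / 4) = 1 + s := by
    rw [hs]; field_simp
  rw [e1] at key
  have h3 : (1 + s) ^ 3 ≤ 1 + 7 * s := by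
    nlinarith [mul_nonneg hs0 (sub_nonneg.2 hs1),
    mul_nonneg (mul_nonneg hs0 hs0) (sub_nonneg.2 hs1)]
  have h4 := mul_le_mul_of_nonneg_right h3 hy0
  have h5 := mul_le_mul_of_nonneg_left hy' hs0
  have e2 : 56 * S / R * t = 14 * (s * S) := by
    rw [hs]; field_simp; ring
  rw [e2]
  linarith

lemma MeanValue.abs_sub_le {f : E3 → ℝ} (hf : Continuous f) {p : E3} {R S : ℝ}
    (hm : MeanValue f (Metric.ball p R)) (hS : ∀ y ∈ Metric.ball p R, |f y| ≤ S)
    {x y : E3} (hx : x ∈ Metric.ball p (R / 2)) (hy : y ∈ Metric.ball p (R / 2))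
    (hxy : dist x y ≤ R / 8) : |f x - f y| ≤ 56 * S / R * dist x y := by
  rw [abs_sub_le_iff]
  refine ⟨hm.sub_le hf hS hx hy hxy, ?_⟩
  rw [dist_comm]
  exact hm.sub_le hf hS hy hx (by rwa [dist_comm])

lemma MeanValue.second_difference {f : E3 → ℝ} (hf : Continuous f) {p : E3} {R S : ℝ}
    (hm : MeanValue f (Metric.ball p R)) (hS : ∀ y ∈ Metric.ball p R, |f y| ≤ S)
    {x h k : E3} (hx : x ∈ Metric.ball p (R / 8)) (hxk : x + k ∈ Metric.ball p (R / 8))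
    (hh : ‖h‖ ≤ R / 8) (hk : ‖k‖ ≤ R / 32) :
    |f (x + h + k) - f (x + h) - f (x + k) + f x| ≤ 12544 * S / R ^ 2 * ‖h‖ * ‖k‖ := by
  have hR : 0 < R := by linarith [dist_nonneg.trans_lt (Metric.mem_ball.1 hx)]
  have hsub : ∀ y ∈ Metric.ball p (R / 4), y + h ∈ Metric.ball p (R / 2) := by
    intro y hy
    rw [mem_ball_iff_norm] at hy ⊢
    have : y + h - p = (y - p) + h := by abel
    rw [this]
    linarith [norm_add_le (y - p) h]
  have hF : Continuous fun z => f (z + h) - f z := by fun_prop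
  have hmF : MeanValue (fun z => f (z + h) - f z) (Metric.ball p (R / 4)) := by
    intro y r hr hb
    rw [ballAvg_sub (by fun_prop) hf, ballAvg_comp_add,
      hm y r hr (hb.trans (Metric.ball_subset_ball (by linarith))), hm (y + h) r hr]
    intro z hz
    have h1 : z - h ∈ Metric.closedBall y r := by
      rw [mem_closedBall_iff_norm] at hz ⊢
      rwa [sub_sub, add_comm h y]
    have h2 := hsub _ (hb h1)
    rw [sub_add_cancel] at h2
    exact Metric.ball_subset_ball (by linarith) h2
  have hSF : ∀ y ∈ Metric.ball p (R / 4), |f (y + h) - f y| ≤ 56 * S / R * ‖h‖ := by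
    intro y hy
    have := hm.abs_sub_le hf hS (hsub y hy) (Metric.ball_subset_ball (by linarith) hy)
      (by simpa using hh)
    simpa using this
  have key := hmF.abs_sub_le hF hSF (x := x + k) (y := x)
    (Metric.ball_subset_ball (by linarith) hxk) (Metric.ball_subset_ball (by linarith) hx)
    (by simp; linarith)
  have e1 : f (x + h + k) - f (x + h) - f (x + k) + f x
      = f (x + k + h) - f (x + k) - (f (x + h) - f x) := by
    rw [add_right_comm]; ring
  rw [e1]
  refine key.trans (le_of_eq ?_)
  simp only [dist_self_add_left]
  field_simp
  ring

lemma MeanValue.differentiableAt {f : E3 → ℝ} (hf : Continuous f) {p : E3} {R S : ℝ} (hR : 0 < R)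
    (hm : MeanValue f (Metric.ball p R)) (hS : ∀ y ∈ Metric.ball p R, |f y| ≤ S)
    {x : E3} (hx : x ∈ Metric.ball p (R / 16)) :
    DifferentiableAt ℝ f x ∧ ‖fderiv ℝ f x‖ ≤ 56 * S / R := by
  have hadd : ∀ h : E3, ‖h‖ ≤ R / 32 → x + h ∈ Metric.ball p (R / 8) := by
    intro h hh
    rw [mem_ball_iff_norm] at hx ⊢
    have : x + h - p = (x - p) + h := by abel
    rw [this]
    linarith [norm_add_le (x - p) h]
  have h1 : ∀ h : E3, ‖h‖ ≤ R / 32 → |f (x + h) - f x| ≤ 56 * S / R * ‖h‖ := by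
    intro h hh
    have := hm.abs_sub_le hf hS (Metric.ball_subset_ball (by linarith) (hadd h hh))
      (Metric.ball_subset_ball (by linarith) hx) (by simp; linarith)
    simpa using this
  have hS0 : 0 ≤ S := (abs_nonneg _).trans (hS p (Metric.mem_ball_self hR))
  have hd : DifferentiableAt ℝ f x := by
    refine differentiableAt_of_second_difference (δ := R / 32)
      (C := 12544 * S / R ^ 2) (by positivity)
      (fun h k hh hk => ?_) h1
    exact hm.second_difference hf hS (Metric.ball_subset_ball (by linarith) hx) (hadd k hk)
      (by linarith) hk
  refine ⟨hd, hd.hasFDerivAt.le_of_lip' (by positivity) ?_⟩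
  filter_upwards [Metric.closedBall_mem_nhds x (by positivity : 0 < R / 32)] with z hz
  rw [mem_closedBall_iff_norm] at hz
  have := h1 _ hz
  rwa [add_sub_cancel] at this

lemma MeanValue.norm_fderiv_sub_le {f : E3 → ℝ} (hf : Continuous f) {p : E3} {R S : ℝ} (hR : 0 < R)
    (hm : MeanValue f (Metric.ball p R)) (hS : ∀ y ∈ Metric.ball p R, |f y| ≤ S)
    {x y : E3} (hx : x ∈ Metric.ball p (R / 64)) (hy : y ∈ Metric.ball p (R / 64)) :
    ‖fderiv ℝ f y - fderiv ℝ f x‖ ≤ 12544 * S / R ^ 2 * ‖y - x‖ := by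
  have hS0 : 0 ≤ S := (abs_nonneg _).trans (hS p (Metric.mem_ball_self hR))
  have hk : ‖y - x‖ ≤ R / 32 := by
    rw [← dist_eq_norm]
    have := dist_triangle_right y x p
    rw [Metric.mem_ball] at hx hy
    linarith
  have hle : R / 64 ≤ R / 8 := by linarith
  have hle' : R / 64 ≤ R / 16 := by linarith
  have hxy : x + (y - x) = y := add_sub_cancel _ _
  have := norm_fderiv_sub_le_of_second_difference (f := f) (x := x) (k := y - x) (δ := R / 8)
    (C := 12544 * S / R ^ 2 * ‖y - x‖) (by positivity) (by positivity)
    (fun h hh => by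
      have := hm.second_difference hf hS (Metric.ball_subset_ball hle hx) (k := y - x) (h := h)
        (by rw [hxy]; exact Metric.ball_subset_ball hle hy) hh hk
      linarith)
    (hm.differentiableAt hf hR hS (Metric.ball_subset_ball hle' hx)).1
    (by rw [hxy]; exact (hm.differentiableAt hf hR hS (Metric.ball_subset_ball hle' hy)).1)
  rwa [hxy] at this

/-- Mean value formulation of the obstacle problem: on the open set `U` the nonnegative function
`φ` satisfies `0 ≤ Δφ ≤ const` everywhere and `Δφ = const` where it is positive. -/
structure ObstacleSolution (φ : E3 → ℝ) (U : Set E3) (c : ℝ) : Prop where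
  continuous : Continuous φ
  nonneg : ∀ x, 0 ≤ φ x
  isOpen : IsOpen U
  const_pos : 0 < c
  le_avg : ∀ x r, 0 < r → Metric.closedBall x r ⊆ U → φ x ≤ ballAvg r φ x
  avg_le : ∀ x r, 0 < r → Metric.closedBall x r ⊆ U → ballAvg r φ x ≤ φ x + c * r ^ 2
  avg_eq : ∀ x r, 0 < r → Metric.closedBall x r ⊆ U →
    (∀ y ∈ Metric.closedBall x r, 0 < φ y) → ballAvg r φ x = φ x + c * r ^ 2

namespace ObstacleSolution

variable {φ : E3 → ℝ} {U : Set E3} {c : ℝ}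

lemma growth (h : ObstacleSolution φ U c) {x₀ : E3} (h0 : φ x₀ = 0) {r : ℝ} (hr : 0 < r)
    (hU : Metric.closedBall x₀ (2 * r) ⊆ U) {y : E3} (hy : dist y x₀ ≤ r) :
    φ y ≤ 32 * c * r ^ 2 := by
  have h1 := h.le_avg y r hr ((Metric.closedBall_subset_closedBall' (by linarith)).trans hU)
  have h2 := ballAvg_le_ballAvg h.continuous hr hy (fun z _ => h.nonneg z)
  have h3 := h.avg_le x₀ (2 * r) (by linarith) hU
  have e : (r + r) / r = 2 := by field_simp; norm_num
  rw [e, ← two_mul] at h2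
  rw [h0] at h3
  linarith

lemma nondegenerate (h : ObstacleSolution φ U c) {x₁ : E3} (h1 : 0 < φ x₁) {r : ℝ} (hr : 0 < r)
    (hU : Metric.closedBall x₁ r ⊆ U) :
    ∃ y, dist y x₁ = r ∧ c / ballMoment / 2 * r ^ 2 ≤ φ y := by
  have hm := ballMoment_pos
  set a := c / ballMoment / 2 with ha
  have ham : a * ballMoment = c / 2 := by rw [ha]; field_simp
  have ha0 : 0 < a := by have := h.const_pos; positivity
  have hf : Continuous fun y => φ y - a * ‖y - x₁‖ ^ 2 := by
    have := h.continuous; fun_prop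
  obtain ⟨y, hy, hmax⟩ := (isCompact_closedBall x₁ r).exists_isMaxOn
    ⟨x₁, Metric.mem_closedBall_self hr.le⟩ hf.continuousOn
  have hmax' : ∀ z ∈ Metric.closedBall x₁ r,
      φ z - a * ‖z - x₁‖ ^ 2 ≤ φ y - a * ‖y - x₁‖ ^ 2 := hmax
  have hx := hmax' x₁ (Metric.mem_closedBall_self hr.le)
  simp only [sub_self, norm_zero] at hx
  have hyφ : 0 < φ y := by nlinarith [mul_nonneg ha0.le (sq_nonneg ‖y - x₁‖)]
  rcases (Metric.mem_closedBall.1 hy).lt_or_eq with hlt | heq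
  · exfalso
    have hopen : IsOpen ({z | 0 < φ z} ∩ Metric.ball x₁ r) :=
      (isOpen_lt continuous_const h.continuous).inter Metric.isOpen_ball
    obtain ⟨ρ, hρ, hsub⟩ := Metric.nhds_basis_closedBall.mem_iff.1
      (hopen.mem_nhds ⟨hyφ, Metric.mem_ball.2 hlt⟩)
    have hsub' : Metric.closedBall y ρ ⊆ Metric.closedBall x₁ r :=
      fun z hz => Metric.ball_subset_closedBall (hsub hz).2
    have e1 := h.avg_eq y ρ hρ (hsub'.trans hU) (fun z hz => (hsub hz).1)
    have e2 := ballAvg_mono hf continuous_const hρ.le (fun z hz => hmax' z (hsub' hz))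
    rw [ballAvg_const, ballAvg_sub h.continuous (by fun_prop), ballAvg_const_mul,
      ballAvg_norm_sub_sq, e1] at e2
    have : 0 < c * ρ ^ 2 := mul_pos h.const_pos (by positivity)
    have e3 : a * (‖y - x₁‖ ^ 2 + ballMoment * ρ ^ 2) = a * ‖y - x₁‖ ^ 2
      + (a * ballMoment) * ρ ^ 2 := by ring
    rw [e3, ham] at e2
    linarith
  · refine ⟨y, heq, ?_⟩
    rw [← dist_eq_norm, heq] at hx
    nlinarith

lemma regular_of_pos (h : ObstacleSolution φ U c) {x : E3} {ρ S : ℝ} (hρ : 0 < ρ)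
    (hU : Metric.ball x ρ ⊆ U) (hpos : ∀ y ∈ Metric.ball x ρ, 0 < φ y)
    (hS : ∀ y ∈ Metric.ball x ρ, φ y ≤ S * ρ ^ 2) :
    DifferentiableAt ℝ φ x ∧ ‖fderiv ℝ φ x‖ ≤ 56 * (S + c / ballMoment) * ρ ∧
    ∀ y ∈ Metric.ball x (ρ / 64), ‖fderiv ℝ φ y - fderiv ℝ φ x‖
      ≤ (12544 * (S + c / ballMoment) + 2 * (c / ballMoment)) * dist y x := by
  have hm := ballMoment_pos
  set b := c / ballMoment with hb
  have hb0 : 0 < b := div_pos h.const_pos hm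
  have hbm : b * ballMoment = c := by rw [hb]; field_simp
  set f : E3 → ℝ := fun y => φ y - b * ‖y - x‖ ^ 2 with hf
  have hφ := h.continuous
  have hfc : Continuous f := by fun_prop
  have hmv : MeanValue f (Metric.ball x ρ) := by
    intro y s hs hsub
    rw [ballAvg_sub hφ (by fun_prop), ballAvg_const_mul, ballAvg_norm_sub_sq,
      h.avg_eq y s hs (hsub.trans hU) (fun z hz => hpos z (hsub hz))]
    simp only [hf]
    linear_combination (-s ^ 2) * hbm
  have hfS : ∀ y ∈ Metric.ball x ρ, |f y| ≤ (S + b) * ρ ^ 2 := by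
    intro y hy
    have h1 := hS y hy
    have h2 := h.nonneg y
    have h3 : ‖y - x‖ ^ 2 ≤ ρ ^ 2 := by
      rw [mem_ball_iff_norm] at hy
      gcongr
    have h4 := mul_le_mul_of_nonneg_left h3 hb0.le
    have h5 : 0 ≤ b * ‖y - x‖ ^ 2 := by positivity
    simp only [hf]
    rw [abs_le]
    constructor <;> nlinarith
  have hq : ∀ y, HasFDerivAt (fun y => b * ‖y - x‖ ^ 2)
      ((2 * b) • innerSL ℝ (y - x)) y := by
    intro y
    have := ((((hasFDerivAt_id y).sub_const x).norm_sq).const_mul b)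
    refine this.congr_fderiv ?_
    ext v
    simp
    ring
  have hsplit : φ = fun y => f y + b * ‖y - x‖ ^ 2 := by
    ext y; simp [hf]
  have hD : ∀ y ∈ Metric.ball x (ρ / 16),
      HasFDerivAt φ (fderiv ℝ f y + (2 * b) • innerSL ℝ (y - x)) y := by
    intro y hy
    rw [hsplit]
    exact (hmv.differentiableAt hfc hρ hfS hy).1.hasFDerivAt.add (hq y)
  have hx : x ∈ Metric.ball x (ρ / 16) := Metric.mem_ball_self (by positivity)
  have ex : fderiv ℝ φ x = fderiv ℝ f x := by
    rw [(hD x hx).fderiv]; simp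
  refine ⟨(hD x hx).differentiableAt, ?_, fun y hy => ?_⟩
  · rw [ex]
    refine (hmv.differentiableAt hfc hρ hfS hx).2.trans (le_of_eq ?_)
    field_simp
  · have hy' : y ∈ Metric.ball x (ρ / 16) := Metric.ball_subset_ball (by linarith) hy
    have h1 := hmv.norm_fderiv_sub_le hfc hρ hfS (Metric.mem_ball_self (by positivity)) hy
    have h2 : ‖(2 * b) • innerSL ℝ (y - x)‖ = 2 * b * ‖y - x‖ := by
      rw [norm_smul, innerSL_apply_norm, Real.norm_of_nonneg (by positivity)]
    rw [(hD y hy').fderiv, ex, add_sub_right_comm, dist_eq_norm]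
    refine (norm_add_le _ _).trans ?_
    rw [h2]
    have e : 12544 * ((S + b) * ρ ^ 2) / ρ ^ 2 = 12544 * (S + b) := by field_simp
    rw [e] at h1
    linarith

lemma hasFDerivAt_zero (h : ObstacleSolution φ U c) {x : E3} (h0 : φ x = 0) (hx : x ∈ U) :
    HasFDerivAt φ (0 : E3 →L[ℝ] ℝ) x := by
  obtain ⟨ε, hε, hsub⟩ := Metric.nhds_basis_closedBall.mem_iff.1 (h.isOpen.mem_nhds hx)
  rw [hasFDerivAt_iff_isLittleO_nhds_zero]
  have hO : (fun v => φ (x + v) - φ x - (0 : E3 →L[ℝ] ℝ) v) =O[nhds 0] fun v => ‖v‖ ^ 2 := by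
    apply Asymptotics.IsBigO.of_bound (32 * c)
    filter_upwards [Metric.closedBall_mem_nhds (0:E3) (by positivity : 0 < ε / 2)] with v hv
    rw [mem_closedBall_zero_iff] at hv
    rw [h0, Real.norm_of_nonneg (by simpa using h.nonneg (x + v)),
      Real.norm_of_nonneg (by positivity)]
    rcases (norm_nonneg v).eq_or_lt with hv0 | hv0
    · have : v = 0 := by rwa [eq_comm, norm_eq_zero] at hv0
      simp [this, h0]
    · simpa using h.growth h0 hv0
        ((Metric.closedBall_subset_closedBall (by linarith)).trans hsub) (y := x + v) (by simp)
  exact hO.trans_isLittleO (Asymptotics.isLittleO_norm_pow_id one_lt_two)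

/-- At each point, the gradient is controlled by the distance to the zero set, and it is
Lipschitz on a comparable scale. -/
lemma exists_scale (h : ObstacleSolution φ U c) {p : E3} {R : ℝ} (hR : 0 < R)
    (hU : Metric.closedBall p (8 * R) ⊆ U) : ∃ C : ℝ, 0 ≤ C ∧ ∀ x ∈ Metric.ball p R,
    DifferentiableAt ℝ φ x ∧ ∃ ρ : ℝ, 0 ≤ ρ ∧ ρ ≤ R ∧ ‖fderiv ℝ φ x‖ ≤ C * ρ ∧
      ∀ y ∈ Metric.ball x (ρ / 64), ‖fderiv ℝ φ y - fderiv ℝ φ x‖ ≤ C * dist y x := by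
  have hm := ballMoment_pos
  have hc := h.const_pos
  obtain ⟨M, hM⟩ := (isCompact_closedBall p (2 * R)).exists_bound_of_continuousOn
    h.continuous.continuousOn
  have hM0 : 0 ≤ M := (norm_nonneg _).trans (hM p (Metric.mem_closedBall_self (by positivity)))
  set S := M / R ^ 2 + 128 * c with hS
  have hSM : M ≤ S * R ^ 2 := by
    have : M = M / R ^ 2 * R ^ 2 := by field_simp
    rw [this, hS]
    gcongr
    linarith
  have hSc : 128 * c ≤ S := by
    have : 0 ≤ M / R ^ 2 := by positivity
    linarith
  set b := c / ballMoment
  have hb : 0 < b := div_pos hc hm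
  set C := 12544 * (S + b) + 2 * b with hC
  have hS0 : 0 ≤ S := by linarith
  have hC0 : 0 ≤ C := by positivity
  have hCle : 56 * (S + b) ≤ C := by linarith
  refine ⟨C, hC0, fun x hx => ?_⟩
  rw [Metric.mem_ball] at hx
  by_cases h0 : φ x = 0
  · have := h.hasFDerivAt_zero h0 (hU (Metric.mem_closedBall.2 (by linarith)))
    refine ⟨this.differentiableAt, 0, le_rfl, hR.le, by simp [this.fderiv], ?_⟩
    intro y hy
    simp at hy
  suffices hsuff : ∃ ρ : ℝ, 0 < ρ ∧ ρ ≤ R ∧ (∀ y ∈ Metric.ball x ρ, 0 < φ y) ∧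
      ∀ y ∈ Metric.ball x ρ, φ y ≤ S * ρ ^ 2 by
    obtain ⟨ρ, hρ, hρR, hpos, hb⟩ := hsuff
    have hsub : Metric.ball x ρ ⊆ U :=
      (Metric.ball_subset_closedBall.trans
        (Metric.closedBall_subset_closedBall' (by linarith))).trans hU
    obtain ⟨h1, h2, h3⟩ := h.regular_of_pos hρ hsub hpos hb
    exact ⟨h1, ρ, hρ.le, hρR, h2.trans (mul_le_mul_of_nonneg_right hCle hρ.le), h3⟩
  by_cases hZ : ∃ z ∈ Metric.closedBall x R, φ z = 0
  · obtain ⟨z, hz, hz0⟩ := hZ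
    have hcl : IsClosed {z | φ z = 0} := isClosed_eq h.continuous continuous_const
    obtain ⟨x₀, hx₀, hd⟩ := hcl.exists_infDist_eq_dist ⟨z, hz0⟩ x
    have hx₀' : φ x₀ = 0 := hx₀
    have hle : dist x x₀ ≤ R := by
      rw [← hd]
      refine (Metric.infDist_le_dist_of_mem (s := {z | φ z = 0}) hz0).trans ?_
      rw [dist_comm]; exact hz
    have hpos : 0 < dist x x₀ := dist_pos.2 fun e => h0 (e ▸ hx₀')
    refine ⟨dist x x₀, hpos, hle, fun y hy => ?_, fun y hy => ?_⟩
    · refine (h.nonneg y).lt_of_ne fun e => ?_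
      have := Metric.infDist_le_dist_of_mem (x := x) (s := {z | φ z = 0}) e.symm
      rw [hd, dist_comm x y] at this
      exact absurd hy (by simpa using this)
    · have hsub : Metric.closedBall x₀ (2 * (2 * dist x x₀)) ⊆ U := by
        refine (Metric.closedBall_subset_closedBall' ?_).trans hU
        have := dist_triangle_left x₀ p x
        linarith
      have hyx : dist y x₀ ≤ 2 * dist x x₀ := by
        have := dist_triangle y x x₀
        rw [Metric.mem_ball] at hy
        linarith
      have := h.growth hx₀' (by positivity) hsub hyx
      nlinarith [sq_nonneg (dist x x₀)]
  · push Not at hZ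
    refine ⟨R, hR, le_rfl, fun y hy => ?_, fun y hy => ?_⟩
    · exact (h.nonneg y).lt_of_ne (hZ y (Metric.ball_subset_closedBall hy)).symm
    · refine (le_abs_self _).trans ((hM y ?_).trans hSM)
      rw [Metric.mem_closedBall]
      rw [Metric.mem_ball] at hy
      linarith [dist_triangle y x p]

lemma exists_lipschitz_fderiv (h : ObstacleSolution φ U c) {p : E3} {R : ℝ} (hR : 0 < R)
    (hU : Metric.closedBall p (8 * R) ⊆ U) : ∃ C : ℝ, 0 ≤ C ∧
    (∀ x ∈ Metric.ball p R, DifferentiableAt ℝ φ x ∧ ‖fderiv ℝ φ x‖ ≤ C) ∧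
    ∀ x ∈ Metric.ball p R, ∀ y ∈ Metric.ball p R,
      ‖fderiv ℝ φ y - fderiv ℝ φ x‖ ≤ C * dist y x := by
  obtain ⟨C, hC, hscale⟩ := h.exists_scale hR hU
  have hCR : 0 ≤ C * R := by positivity
  refine ⟨128 * C + C * R, by positivity, fun x hx => ?_, fun x hx y hy => ?_⟩
  · obtain ⟨h1, ρ, -, h3, h4, -⟩ := hscale x hx
    exact ⟨h1, by linarith [mul_le_mul_of_nonneg_left h3 hC]⟩
  obtain ⟨-, ρ, hρ, -, h1, h2⟩ := hscale x hx
  obtain ⟨-, σ, hσ, -, k1, k2⟩ := hscale y hy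
  have hd : 0 ≤ dist y x := dist_nonneg
  have hle : C * dist y x ≤ (128 * C + C * R) * dist y x := by
    gcongr
    linarith
  by_cases hxy : dist y x < ρ / 64
  · exact (h2 y hxy).trans hle
  by_cases hyx : dist x y < σ / 64
  · rw [norm_sub_rev]
    refine (k2 x hyx).trans ?_
    rwa [dist_comm]
  rw [dist_comm] at hyx
  push Not at hxy hyx
  have h5 : C * (ρ + σ) ≤ C * (128 * dist y x) := by gcongr; linarith
  nlinarith [norm_sub_le (fderiv ℝ φ y) (fderiv ℝ φ x)]

lemma differentiableAt (h : ObstacleSolution φ U c) {x : E3} (hx : x ∈ U) :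
    DifferentiableAt ℝ φ x := by
  obtain ⟨ε, hε, hsub⟩ := Metric.nhds_basis_closedBall.mem_iff.1 (h.isOpen.mem_nhds hx)
  obtain ⟨C, -, h1, -⟩ := h.exists_lipschitz_fderiv (R := ε / 8) (by positivity)
    ((Metric.closedBall_subset_closedBall (by linarith)).trans hsub)
  exact (h1 x (Metric.mem_ball_self (by positivity))).1

lemma exists_lipschitzOnWith_gradient (h : ObstacleSolution φ U c) {K : Set E3}
    (hK : IsCompact K) (hKU : K ⊆ U) : ∃ L : NNReal, LipschitzOnWith L (gradient φ) K := by
  refine LocallyLipschitzOn.exists_lipschitzOnWith_of_compact hK fun x hx => ?_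
  obtain ⟨ε, hε, hsub⟩ := Metric.nhds_basis_closedBall.mem_iff.1 (h.isOpen.mem_nhds (hKU hx))
  obtain ⟨C, hC, -, h2⟩ := h.exists_lipschitz_fderiv (R := ε / 8) (by positivity)
    ((Metric.closedBall_subset_closedBall (by linarith)).trans hsub)
  refine ⟨⟨C, hC⟩, Metric.ball x (ε / 8),
    mem_nhdsWithin_of_mem_nhds (Metric.ball_mem_nhds x (by positivity)), ?_⟩
  refine LipschitzOnWith.of_dist_le_mul fun y hy z hz => ?_
  rw [gradient, gradient, LinearIsometryEquiv.dist_map, dist_eq_norm]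
  exact h2 z hz y hy

end ObstacleSolution

section IteratedAverages

variable {f : E3 → ℝ} {r : ℝ}

lemma continuous_iterate_ballAvg (hf : Continuous f) (r : ℝ) (k : ℕ) :
    Continuous ((ballAvg r)^[k] f) := by
  induction k with
  | zero => exact hf
  | succ k ih =>
    rw [Function.iterate_succ_apply']
    exact continuous_ballAvg ih r

lemma iterate_ballAvg_nonneg (hf : ∀ x, 0 ≤ f x) (r : ℝ) (k : ℕ) (x : E3) :
    0 ≤ (ballAvg r)^[k] f x := by
  induction k generalizing x with
  | zero => exact hf x
  | succ k ih =>
    rw [Function.iterate_succ_apply']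
    exact integral_nonneg fun z => ih _

lemma iterate_ballAvg_le (hf : Continuous f) (hr : 0 ≤ r) {p : E3} {S B : ℝ}
    (h : ∀ y, dist y p ≤ S → f y ≤ B) (k : ℕ) {x : E3} (hx : dist x p + k * r ≤ S) :
    (ballAvg r)^[k] f x ≤ B := by
  induction k generalizing x with
  | zero => exact h x (by simpa using hx)
  | succ k ih =>
    rw [Function.iterate_succ_apply', ← ballAvg_const r B x]
    refine ballAvg_mono (continuous_iterate_ballAvg hf r k) continuous_const hr fun y hy => ih ?_
    rw [Metric.mem_closedBall] at hy
    push_cast at hx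
    linarith [dist_triangle y x p]

lemma iterate_ballAvg_le_succ (hf : Continuous f) (hr : 0 ≤ r) {p : E3} {S : ℝ}
    (h : ∀ y, dist y p ≤ S → f y ≤ ballAvg r f y) (k : ℕ) {x : E3}
    (hx : dist x p + k * r ≤ S) :
    (ballAvg r)^[k] f x ≤ (ballAvg r)^[k + 1] f x := by
  induction k generalizing x with
  | zero => exact h x (by simpa using hx)
  | succ k ih =>
    rw [Function.iterate_succ_apply', Function.iterate_succ_apply' _ (k + 1)]
    refine ballAvg_mono (continuous_iterate_ballAvg hf r k)
      (continuous_iterate_ballAvg hf r (k + 1)) hr fun y hy => ih ?_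
    rw [Metric.mem_closedBall] at hy
    push_cast at hx
    linarith [dist_triangle y x p]

lemma iterate_ballAvg_mono (hf : Continuous f) (hr : 0 ≤ r) {p : E3} {S : ℝ}
    (h : ∀ y, dist y p ≤ S → f y ≤ ballAvg r f y) {j k : ℕ} (hjk : j ≤ k) {x : E3}
    (hx : dist x p + k * r ≤ S) :
    (ballAvg r)^[j] f x ≤ (ballAvg r)^[k] f x := by
  induction k, hjk using Nat.le_induction with
  | base => exact le_rfl
  | succ k _ ih =>
    push_cast at hx
    exact (ih (by linarith)).trans (iterate_ballAvg_le_succ hf hr h k (by linarith))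

lemma mul_pow_le_ballAvg {g : E3 → ℝ} (hg : Continuous g) (h0 : ∀ x, 0 ≤ g x) (hr : 0 < r)
    {δ a : ℝ} (hδ : 0 < δ) {x y : E3} (hxy : dist x y + δ * r ≤ r)
    (ha : ∀ z ∈ Metric.closedBall y (δ * r), a ≤ g z) : a * δ ^ 3 ≤ ballAvg r g x := by
  have h1 := ballAvg_le_ballAvg hg (mul_pos hδ hr) (x := y) (y := x) (t := r - δ * r)
    (by rw [dist_comm]; linarith) (fun z _ => h0 z)
  have h2 := ballAvg_mono continuous_const hg (mul_pos hδ hr).le ha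
  rw [ballAvg_const] at h2
  have e : (δ * r + (r - δ * r)) / (δ * r) = δ⁻¹ := by field_simp; ring
  rw [e, add_sub_cancel] at h1
  calc a * δ ^ 3 ≤ δ⁻¹ ^ 3 * ballAvg r g x * δ ^ 3 := by gcongr; exact h2.trans h1
    _ = ballAvg r g x := by field_simp

lemma mul_pow_le_iterate_ballAvg (hf : Continuous f) (h0 : ∀ x, 0 ≤ f x) (hr : 0 < r)
    {δ a : ℝ} (hδ : 0 < δ) (hδ' : δ ≤ 1 / 4) (n : ℕ) (p : ℕ → E3)
    (hp : ∀ i < n, dist (p i) (p (i + 1)) ≤ r / 2)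
    (ha : ∀ z ∈ Metric.closedBall (p n) (δ * r), a ≤ f z) {x : E3}
    (hx : x ∈ Metric.closedBall (p 0) (δ * r)) : a * (δ ^ 3) ^ n ≤ (ballAvg r)^[n] f x := by
  induction n generalizing p x with
  | zero => simpa using ha x hx
  | succ n ih =>
    rw [Function.iterate_succ_apply', pow_succ, ← mul_assoc]
    refine mul_pow_le_ballAvg (continuous_iterate_ballAvg hf r n) (iterate_ballAvg_nonneg h0 r n)
      hr hδ (y := p 1) ?_ fun z hz => ih (fun i => p (i + 1)) (fun i hi => hp _ (by omega)) ha hz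
    have h1 := hp 0 (by omega)
    rw [Metric.mem_closedBall] at hx
    have h2 : δ * r ≤ 1 / 4 * r := by gcongr
    rw [zero_add] at h1
    linarith [dist_triangle x (p 0) (p 1)]

end IteratedAverages

section TestFunctions

variable {ζ : E3 → ℝ}

lemma exists_abs_ballAvg_sub_le (hζ : ContDiff ℝ 2 ζ) (hs : HasCompactSupport ζ) :
    ∃ C : ℝ, 0 ≤ C ∧ ∀ r, 0 ≤ r → ∀ x, |ballAvg r ζ x - ζ x| ≤ C * r ^ 2 := by
  obtain ⟨C, hC⟩ := (hζ.fderiv_right (m := 1) (by norm_num)).lipschitzWith_of_hasCompactSupport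
    (hs.fderiv (𝕜 := ℝ)) (by norm_num)
  refine ⟨C, C.2, fun r hr x => ?_⟩
  have hd : Differentiable ℝ ζ := hζ.differentiable (by norm_num)
  have hlin : ∫ z, fderiv ℝ ζ x (r • z) ∂uball = 0 :=
    integral_uball_odd fun z => by rw [smul_neg, map_neg]
  have h1 : ballAvg r ζ x - ζ x
      = ∫ z, (ζ (x + r • z) - ζ x - fderiv ℝ ζ x (r • z)) ∂uball := by
    have hc := hζ.continuous
    rw [integral_sub (integrable_uball (by fun_prop)) (integrable_uball (by fun_prop)), hlin,
      integral_sub (integrable_uball (by fun_prop)) (integrable_const _)]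
    simp [ballAvg]
  rw [h1, ← Real.norm_eq_abs, ← mul_one (C * r ^ 2 : ℝ), ← probReal_univ (μ := uball)]
  refine norm_integral_le_of_norm_le_const ?_
  filter_upwards [ae_uball_norm_le] with z hz
  have hv : ‖r • z‖ ≤ r := by
    rw [norm_smul, Real.norm_of_nonneg hr]
    exact mul_le_of_le_one_right hr hz
  have := (convex_closedBall x r).norm_image_sub_le_of_norm_fderiv_le' (𝕜 := ℝ) (f := ζ)
    (C := C * r) (φ := fderiv ℝ ζ x) (fun y _ => hd y) (fun y hy => ?_)
    (Metric.mem_closedBall_self hr) (add_smul_mem_closedBall hr x hz)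
  · rw [add_sub_cancel_left] at this
    refine this.trans ?_
    rw [pow_two, ← mul_assoc]
    gcongr
  · rw [← dist_eq_norm]
    refine (hC.dist_le_mul y x).trans ?_
    gcongr
    exact hy

lemma integrable_prod_uball {G : E3 × E3 → ℝ} (hG : Continuous G) {K : Set E3}
    (hK : IsCompact K) (h0 : ∀ x z, ‖z‖ ≤ 1 → x ∉ K → G (x, z) = 0) :
    Integrable G ((volume : Measure E3).prod uball) := by
  obtain ⟨D, hD⟩ := (hK.prod (isCompact_closedBall (0:E3) 1)).exists_bound_of_continuousOn
    hG.continuousOn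
  have hdom : Integrable (fun q : E3 × E3 => K.indicator (fun _ => D) q.1)
      ((volume : Measure E3).prod uball) := by
    refine Integrable.comp_fst (f := K.indicator fun _ => D) ?_ uball
    exact (integrable_indicator_iff hK.measurableSet).2
      (integrableOn_const hK.measure_lt_top.ne)
  refine hdom.mono' hG.aestronglyMeasurable ?_
  filter_upwards [Measure.quasiMeasurePreserving_snd.ae ae_uball_norm_le] with q hq
  by_cases h : q.1 ∈ K
  · rw [Set.indicator_of_mem h]
    exact hD q ⟨h, by simpa using hq⟩
  · rw [Set.indicator_of_notMem h, ← Prod.mk.eta (p := q), h0 _ _ hq h, norm_zero]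

/-- Averaging over balls is a symmetric operation. -/
lemma integral_mul_ballAvg (hζ : Continuous ζ) (hs : HasCompactSupport ζ) {f : E3 → ℝ}
    (hf : Continuous f) (r : ℝ) : ∫ x, ζ x * ballAvg r f x = ∫ x, ballAvg r ζ x * f x := by
  have hint : Integrable (fun q : E3 × E3 => ζ q.1 * f (q.1 + r • q.2))
      ((volume : Measure E3).prod uball) :=
    integrable_prod_uball (by fun_prop) hs.isCompact fun x z _ hx => by
      simp [image_eq_zero_of_notMem_tsupport hx]
  have hint' : Integrable (fun q : E3 × E3 => ζ (q.1 + r • q.2) * f q.1)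
      ((volume : Measure E3).prod uball) := by
    have hcomp : IsCompact ((fun q : E3 × E3 => q.1 - r • q.2) ''
        (tsupport ζ ×ˢ Metric.closedBall (0:E3) 1)) :=
      (hs.isCompact.prod (isCompact_closedBall _ _)).image (by fun_prop)
    refine integrable_prod_uball (by fun_prop) hcomp fun x z hz hx => ?_
    have : x + r • z ∉ tsupport ζ := fun h =>
      hx ⟨(x + r • z, z), ⟨h, by simpa using hz⟩, by simp⟩
    simp [image_eq_zero_of_notMem_tsupport this]
  calc ∫ x, ζ x * ballAvg r f x = ∫ x, (∫ z, ζ x * f (x + r • z) ∂uball) := by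
        simp only [ballAvg, integral_const_mul]
    _ = ∫ z, (∫ x, ζ x * f (x + r • z)) ∂uball := integral_integral_swap hint
    _ = ∫ z, (∫ x, ζ (x + r • (-z)) * f x) ∂uball := by
        congr 1
        ext z
        rw [← integral_add_right_eq_self (fun x => ζ (x + r • (-z)) * f x) (r • z)]
        simp
    _ = ∫ z, (∫ x, ζ (x + r • z) * f x) ∂uball :=
        integral_uball_neg fun z => ∫ x, ζ (x + r • z) * f x
    _ = ∫ x, (∫ z, ζ (x + r • z) * f x ∂uball) := (integral_integral_swap hint').symm
    _ = ∫ x, ballAvg r ζ x * f x := by simp only [ballAvg, integral_mul_const]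

lemma integral_mul_iterate_ballAvg_sub_le (hζ : Continuous ζ) (hs : HasCompactSupport ζ)
    {f : E3 → ℝ} (hf : Continuous f) {r C : ℝ} (hr : 0 ≤ r)
    (hC : ∀ x, |ballAvg r ζ x - ζ x| ≤ C * r ^ 2) {p : E3} {S B : ℝ}
    (hS : ∀ x, S < dist x p + r → ζ x = 0) (n : ℕ)
    (hB : ∀ j < n, ∀ x ∈ Metric.closedBall p S, |(ballAvg r)^[j] f x| ≤ B) :
    ∫ x, ζ x * ((ballAvg r)^[n] f x - f x)
      ≤ n * (C * r ^ 2 * B * volume.real (Metric.closedBall p S)) := by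
  have hint : ∀ g : E3 → ℝ, Continuous g → Integrable fun x => ζ x * g x := fun g hg =>
    (hζ.mul hg).integrable_of_hasCompactSupport hs.mul_right
  induction n with
  | zero => simp
  | succ n ih =>
    have hcn := continuous_iterate_ballAvg hf r n
    have hstep : ∫ x, ζ x * ((ballAvg r)^[n + 1] f x - (ballAvg r)^[n] f x)
        ≤ C * r ^ 2 * B * volume.real (Metric.closedBall p S) := by
      set g := (ballAvg r)^[n] f
      have hz : ∀ x, x ∉ Metric.closedBall p S → ballAvg r ζ x - ζ x = 0 := by
        intro x hx
        rw [Metric.mem_closedBall, not_le] at hx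
        rw [hS x (by linarith), sub_zero, ← ballAvg_const r 0 x]
        refine ballAvg_congr hr fun y hy => hS y ?_
        rw [Metric.mem_closedBall] at hy
        linarith [dist_triangle_left x p y]
      have e1 : ∫ x, ζ x * ((ballAvg r)^[n + 1] f x - g x)
          = ∫ x, (ballAvg r ζ x - ζ x) * g x := by
        rw [Function.iterate_succ_apply']
        simp only [mul_sub, sub_mul]
        have hc1 : Integrable fun x => ballAvg r ζ x * g x := by
          refine ((continuous_ballAvg hζ r).mul hcn).integrable_of_hasCompactSupport ?_
          refine HasCompactSupport.mul_right ?_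
          refine HasCompactSupport.intro (isCompact_closedBall p S) fun x hx => ?_
          have h1 := hz x hx
          rw [Metric.mem_closedBall, not_le] at hx
          rwa [hS x (by linarith), sub_zero] at h1
        rw [integral_sub (hint _ (continuous_ballAvg hcn r)) (hint _ hcn),
          integral_sub hc1 (hint _ hcn), integral_mul_ballAvg hζ hs hcn]
      rw [e1, ← setIntegral_eq_integral_of_forall_compl_eq_zero (s := Metric.closedBall p S)
        (fun x hx => by rw [hz x hx, zero_mul])]
      refine (Real.le_norm_self _).trans (norm_setIntegral_le_of_norm_le_const
        (isCompact_closedBall p S).measure_lt_top fun x hx => ?_)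
      rw [norm_mul]
      exact mul_le_mul (hC x) (hB n (by omega) x hx) (norm_nonneg _)
        ((abs_nonneg _).trans (hC x))
    have e2 : ∀ x, ζ x * ((ballAvg r)^[n + 1] f x - f x)
        = ζ x * ((ballAvg r)^[n] f x - f x)
          + ζ x * ((ballAvg r)^[n + 1] f x - (ballAvg r)^[n] f x) := fun x => by ring
    have hc' := continuous_iterate_ballAvg hf r (n + 1)
    simp only [e2]
    rw [integral_add (hint (fun x => (ballAvg r)^[n] f x - f x) (by fun_prop))
      (hint (fun x => (ballAvg r)^[n + 1] f x - (ballAvg r)^[n] f x) (by fun_prop))]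
    push_cast
    linarith [ih fun j hj => hB j (by omega)]

end TestFunctions

/-- The truncated maximal increment of `φ` at scale `r`. -/
def increment (φ : E3 → ℝ) (q r : ℝ) (x : E3) : ℝ :=
  max 0 (sSup ((fun h => φ (x + h)) '' Metric.closedBall 0 r) - φ x - q)

section Increment

variable {φ : E3 → ℝ} {q r : ℝ} {x : E3}

lemma increment_nonneg (φ : E3 → ℝ) (q r : ℝ) (x : E3) : 0 ≤ increment φ q r x :=
  le_max_left _ _

lemma continuous_increment (hφ : Continuous φ) (q r : ℝ) : Continuous (increment φ q r) := by
  have h : Continuous fun x : E3 => sSup ((fun h => φ (x + h)) '' Metric.closedBall 0 r) :=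
    (isCompact_closedBall (0:E3) r).continuous_sSup (f := fun x h => φ (x + h)) (by fun_prop)
  unfold increment
  fun_prop

lemma le_increment (hφ : Continuous φ) {h : E3} (hh : ‖h‖ ≤ r) :
    φ (x + h) - φ x - q ≤ increment φ q r x := by
  have hb : BddAbove ((fun h => φ (x + h)) '' Metric.closedBall 0 r) :=
    (isCompact_closedBall (0:E3) r).bddAbove_image (by fun_prop)
  have := le_csSup hb ⟨h, mem_closedBall_zero_iff.2 hh, rfl⟩
  refine le_trans ?_ (le_max_right _ _)
  linarith

lemma exists_increment_eq (hφ : Continuous φ) (q : ℝ) (hr : 0 ≤ r) (x : E3) :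
    ∃ h, ‖h‖ ≤ r ∧ increment φ q r x = max 0 (φ (x + h) - φ x - q) := by
  obtain ⟨h, hh, e⟩ := (isCompact_closedBall (0:E3) r).exists_sSup_image_eq
    ⟨0, Metric.mem_closedBall_self hr⟩ (f := fun h => φ (x + h)) (by fun_prop)
  exact ⟨h, mem_closedBall_zero_iff.1 hh, by rw [increment, e]⟩

end Increment

namespace ObstacleSolution

variable {φ : E3 → ℝ} {U : Set E3} {c : ℝ}

lemma increment_eq_zero (h : ObstacleSolution φ U c) {r : ℝ} (hr : 0 < r) {x z : E3}
    (hz : φ z = 0) (hd : dist x z ≤ 2 * r) (hU : Metric.closedBall z (6 * r) ⊆ U) :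
    increment φ (288 * c * r ^ 2) r x = 0 := by
  obtain ⟨v, hv, e⟩ := exists_increment_eq h.continuous (288 * c * r ^ 2) hr.le x
  rw [e, max_eq_left]
  have h1 := h.growth hz (r := 3 * r) (by positivity) (by convert hU using 2; ring) (y := x + v) (by
    have := dist_triangle (x + v) x z
    rw [dist_self_add_left] at this
    linarith)
  linarith [h.nonneg x]

lemma increment_le_ballAvg (h : ObstacleSolution φ U c) {r : ℝ} (hr : 0 < r) {x : E3}
    (hU : Metric.closedBall x (8 * r) ⊆ U) :
    increment φ (288 * c * r ^ 2) r x ≤ ballAvg r (increment φ (288 * c * r ^ 2) r) x := by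
  set q := 288 * c * r ^ 2 with hq
  have hφ := h.continuous
  obtain ⟨v, hv, e⟩ := exists_increment_eq hφ q hr.le x
  rcases (increment_nonneg φ q r x).eq_or_lt with h0 | hpos
  · rw [← h0]
    exact integral_nonneg fun z => increment_nonneg _ _ _ _
  have hnz : ∀ z, dist x z ≤ 2 * r → 0 < φ z := by
    intro z hz
    refine (h.nonneg z).lt_of_ne fun hz0 => hpos.ne' (h.increment_eq_zero hr hz0.symm hz ?_)
    refine (Metric.closedBall_subset_closedBall' ?_).trans hU
    rw [dist_comm]; linarith
  have hxv : dist (x + v) x ≤ r := by simpa using hv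
  have e1 := h.avg_eq x r hr ((Metric.closedBall_subset_closedBall (by linarith)).trans hU)
    fun z hz => hnz z (by rw [Metric.mem_closedBall, dist_comm] at hz; linarith)
  have e2 := h.avg_eq (x + v) r hr
    ((Metric.closedBall_subset_closedBall' (by linarith)).trans hU) fun z hz => hnz z (by
      rw [Metric.mem_closedBall, dist_comm] at hz
      linarith [dist_triangle_left x z (x + v)])
  have e3 : increment φ q r x = φ (x + v) - φ x - q := by
    rw [e, max_eq_right]
    by_contra! hlt
    rw [e, max_eq_left hlt.le] at hpos
    exact hpos.false
  have e4 : ballAvg r (fun y => φ (y + v) - φ y - q) x = φ (x + v) - φ x - q := by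
    rw [ballAvg_sub (by fun_prop) continuous_const, ballAvg_sub (by fun_prop) hφ, ballAvg_comp_add,
      ballAvg_const, e1, e2]
    ring
  rw [e3, ← e4]
  exact ballAvg_mono (by fun_prop) (continuous_increment hφ q r) hr.le
    fun y _ => le_increment hφ hv

/-- Near a free boundary point, the iterated averages of the increment are quantitatively
positive. -/
lemma le_iterate_ballAvg_increment (h : ObstacleSolution φ U c) {p x₀ : E3} {R C r δ : ℝ} {M : ℕ}
    (hC : 0 ≤ C) (hU : Metric.closedBall p (8 * R) ⊆ U)
    (hd : ∀ x ∈ Metric.ball p R, DifferentiableAt ℝ φ x)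
    (hl : ∀ x ∈ Metric.ball p R, ∀ y ∈ Metric.ball p R,
      ‖fderiv ℝ φ y - fderiv ℝ φ x‖ ≤ C * dist y x)
    (hM : 1 ≤ M) (hM' : 8 * (288 * c + 2) ≤ c / ballMoment * M)
    (hδ : 0 < δ) (hδ' : δ ≤ 1 / 4) (hδC : 2 * C * (M + 3) * δ ≤ 1) (hr : 0 < r)
    (hr' : 4 * (M + 3) * r ≤ R) (hx₀ : φ x₀ = 0) (hx₀' : x₀ ∈ closure {x | 0 < φ x})
    (hx₀p : dist x₀ p ≤ R / 8) {x : E3} (hx : x ∈ Metric.closedBall x₀ (δ * r)) :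
    r ^ 2 * (δ ^ 3) ^ (2 * (M + 1)) ≤
      (ballAvg r)^[2 * (M + 1)] (increment φ (288 * c * r ^ 2) r) x := by
  have hφ := h.continuous
  set q := 288 * c * r ^ 2 with hq
  set b := c / ballMoment with hb
  have hb0 : 0 < b := div_pos h.const_pos ballMoment_pos
  have hM1 : (1:ℝ) ≤ M := by exact_mod_cast hM
  have hMr : 0 < (M:ℝ) * r := by positivity
  have hRr : 16 * r ≤ R := by nlinarith
  have hMrR : 4 * (M * r) + 12 * r ≤ R := by linarith
  obtain ⟨x₁, hx₁, hx₁d⟩ := Metric.mem_closure_iff.1 hx₀' r hr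
  obtain ⟨y, hyd, hy⟩ := h.nondegenerate hx₁ hMr
    ((Metric.closedBall_subset_closedBall' (by
      linarith [dist_triangle_left x₁ p x₀])).trans hU)
  have hyx₀ : dist y x₀ ≤ (M + 1) * r := by
    have := dist_triangle_right y x₀ x₁
    linarith
  set n := 2 * (M + 1) with hn
  have hn0 : (0:ℝ) < n := by rw [hn]; positivity
  have hn1 : (n:ℝ) = 2 * (M + 1) := by rw [hn]; push_cast; ring
  set P : ℕ → E3 := fun i => x₀ + ((i:ℝ) / n) • (y - x₀) with hP
  have hP0 : P 0 = x₀ := by simp [hP]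
  have hPn : P n = y := by simp [hP]
  have hPsub : ∀ i, P (i + 1) - P i = (1 / n : ℝ) • (y - x₀) := by
    intro i
    simp only [hP]
    rw [add_sub_add_left_eq_sub, ← sub_smul]
    congr 1
    push_cast
    ring
  have hPstep : ∀ i, ‖P (i + 1) - P i‖ ≤ r / 2 := by
    intro i
    rw [hPsub, norm_smul, Real.norm_of_nonneg (by positivity), ← dist_eq_norm]
    calc 1 / (n:ℝ) * dist y x₀ ≤ 1 / n * ((M + 1) * r) := by gcongr
      _ = r / 2 := by rw [hn1]; field_simp
  have hPd : ∀ i ≤ n, dist (P i) x₀ ≤ (M + 1) * r := by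
    intro i hi
    rw [dist_eq_norm]
    simp only [hP]
    rw [add_sub_cancel_left, norm_smul, Real.norm_of_nonneg (by positivity), ← dist_eq_norm]
    refine (mul_le_of_le_one_left dist_nonneg ?_).trans hyx₀
    rw [div_le_one hn0]
    exact_mod_cast hi
  obtain ⟨i, hi, hgain⟩ : ∃ i ∈ Finset.range n,
      (288 * c + 2) * r ^ 2 ≤ φ (P (i + 1)) - φ (P i) := by
    refine Finset.exists_le_of_sum_le (by simp [hn]) ?_
    rw [Finset.sum_range_sub (fun i => φ (P i)), hP0, hPn, hx₀, Finset.sum_const,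
      Finset.card_range, nsmul_eq_mul, hn1, sub_zero]
    refine le_trans ?_ hy
    have h1 : 2 * (M + 1) * ((288 * c + 2) * r ^ 2) ≤ 2 * (2 * M) * ((288 * c + 2) * r ^ 2) := by
      have := h.const_pos
      gcongr
      linarith
    have h2 : 8 * (288 * c + 2) * (M * r ^ 2 / 2) ≤ b * M * (M * r ^ 2 / 2) := by gcongr
    calc _ ≤ _ := h1
      _ = 8 * (288 * c + 2) * (M * r ^ 2 / 2) := by ring
      _ ≤ _ := h2
      _ = _ := by ring
  rw [Finset.mem_range] at hi
  have hx₀U : x₀ ∈ U := hU (Metric.mem_closedBall.2 (by linarith))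
  have hlip : ∀ u ∈ Metric.closedBall x₀ ((M + 3) * r), ∀ v ∈ Metric.closedBall x₀ ((M + 3) * r),
      |φ v - φ u| ≤ C * ((M + 3) * r) * ‖v - u‖ := by
    have hsub : ∀ u ∈ Metric.closedBall x₀ ((M + 3) * r), u ∈ Metric.ball p R := by
      intro u hu
      rw [Metric.mem_closedBall] at hu
      rw [Metric.mem_ball]
      linarith [dist_triangle u x₀ p]
    intro u hu v hv
    refine (convex_closedBall x₀ ((M + 3) * r)).norm_image_sub_le_of_norm_fderiv_le (𝕜 := ℝ)
      (fun z hz => hd z (hsub z hz)) (fun z hz => ?_) hu hv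
    have := hl x₀ (by rw [Metric.mem_ball]; linarith) z (hsub z hz)
    rw [(h.hasFDerivAt_zero hx₀ hx₀U).fderiv, sub_zero] at this
    refine this.trans ?_
    gcongr
    exact hz
  have hball : ∀ z ∈ Metric.closedBall (P i) (δ * r), r ^ 2 ≤ increment φ q r z := by
    intro z hz
    rw [Metric.mem_closedBall] at hz
    have hδr : δ * r ≤ r / 4 := by nlinarith
    have hmem : ∀ u, dist u (P i) ≤ r → u ∈ Metric.closedBall x₀ ((M + 3) * r) := by
      intro u hu
      rw [Metric.mem_closedBall]
      linarith [dist_triangle u (P i) x₀, hPd i hi.le]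
    set v := P (i + 1) - P i with hv
    have hPv : P i + v = P (i + 1) := by rw [hv, add_sub_cancel]
    have h1 := le_increment hφ (q := q) (r := r) (x := z) (h := v) ((hPstep i).trans (by linarith))
    have h2 := hlip z (hmem z (by linarith)) (P i) (hmem _ (by simp [hr.le]))
    have h3 := hlip (z + v) (hmem (z + v) (by
      have := dist_triangle (z + v) z (P i)
      rw [dist_self_add_left] at this
      linarith [hPstep i])) (P i + v) (hmem _ (by
        rw [dist_self_add_left]; linarith [hPstep i]))
    rw [add_sub_add_right_eq_sub] at h3
    have h4 : C * ((M + 3) * r) * ‖P i - z‖ ≤ r ^ 2 / 2 := by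
      rw [← dist_eq_norm, dist_comm]
      calc C * ((M + 3) * r) * dist z (P i) ≤ C * ((M + 3) * r) * (δ * r) := by gcongr
        _ = (2 * C * (M + 3) * δ) * (r ^ 2 / 2) := by ring
        _ ≤ 1 * (r ^ 2 / 2) := by gcongr
        _ = r ^ 2 / 2 := one_mul _
    rw [hPv] at h3
    have h5 := neg_abs_le (φ (P i) - φ z)
    have h6 := le_abs_self (φ (P (i + 1)) - φ (z + v))
    linarith
  have hmono : ∀ y, dist y p ≤ R → increment φ q r y ≤ ballAvg r (increment φ q r) y := by
    intro y hy
    exact h.increment_le_ballAvg hr ((Metric.closedBall_subset_closedBall' (by linarith)).trans hU)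
  have hδ3 : δ ^ 3 ≤ 1 := pow_le_one₀ hδ.le (by linarith)
  have hw := continuous_increment hφ q r
  calc r ^ 2 * (δ ^ 3) ^ n ≤ r ^ 2 * (δ ^ 3) ^ i := by
        have := pow_le_pow_of_le_one (by positivity) hδ3 hi.le
        gcongr
    _ ≤ (ballAvg r)^[i] (increment φ q r) x := by
        refine mul_pow_le_iterate_ballAvg hw (increment_nonneg φ q r) hr hδ hδ' i P
          (fun j _ => ?_) hball (by rwa [hP0])
        rw [dist_comm, dist_eq_norm]
        exact hPstep j
    _ ≤ (ballAvg r)^[n] (increment φ q r) x := by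
        refine iterate_ballAvg_mono hw hr.le hmono hi.le ?_
        rw [Metric.mem_closedBall] at hx
        rw [hn1]
        have : δ * r ≤ r / 4 := by nlinarith
        linarith [dist_triangle x x₀ p]

end ObstacleSolution

namespace ObstacleSolution

variable {φ : E3 → ℝ} {U : Set E3} {c : ℝ}

/-- Separated sets of free boundary points have at most quadratically many elements. -/
lemma exists_card_mul_sq_le (h : ObstacleSolution φ U c) {p : E3} (hp : p ∈ U) :
    ∃ R > 0, ∃ r₀ > 0, ∃ C : ℝ, ∀ r, 0 < r → r ≤ r₀ → ∀ F : Finset E3,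
      (∀ x ∈ F, φ x = 0 ∧ x ∈ closure {x | 0 < φ x} ∧ dist x p ≤ R) →
      (∀ x ∈ F, ∀ y ∈ F, x ≠ y → r < dist x y) → F.card * r ^ 2 ≤ C := by
  obtain ⟨ε, hε, hsub⟩ := Metric.nhds_basis_closedBall.mem_iff.1 (h.isOpen.mem_nhds hp)
  set R := ε / 8 with hR
  have hR0 : 0 < R := by positivity
  have hU : Metric.closedBall p (8 * R) ⊆ U := by
    convert hsub using 2
    rw [hR]; ring
  obtain ⟨C, hC, hd, hl⟩ := h.exists_lipschitz_fderiv hR0 hU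
  have hb0 : 0 < c / ballMoment := div_pos h.const_pos ballMoment_pos
  obtain ⟨M, hM⟩ := exists_nat_ge (max 1 (8 * (288 * c + 2) / (c / ballMoment)))
  have hM1 : 1 ≤ M := by exact_mod_cast (le_max_left _ _).trans hM
  have hM' : 8 * (288 * c + 2) ≤ c / ballMoment * M := by
    rw [← div_le_iff₀' hb0]
    exact (le_max_right _ _).trans hM
  obtain ⟨δ, hδ, hδ', hδC⟩ : ∃ δ : ℝ, 0 < δ ∧ δ ≤ 1 / 4 ∧ 2 * C * (M + 3) * δ ≤ 1 := by
    have hpos : 0 < 2 * C * (M + 3) + 4 := by positivity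
    refine ⟨1 / (2 * C * (M + 3) + 4), by positivity, ?_, ?_⟩
    · apply one_div_le_one_div_of_le (by norm_num)
      have : 0 ≤ 2 * C * (M + 3) := by positivity
      linarith
    · rw [mul_one_div, div_le_one hpos]
      linarith
  let ζ : ContDiffBump p := ⟨R / 4, R / 2, by positivity, by linarith⟩
  have hζc : Continuous ζ := ζ.continuous
  have hζs : HasCompactSupport ζ := ζ.hasCompactSupport
  obtain ⟨Z, hZ, hZ'⟩ := exists_abs_ballAvg_sub_le (ζ := ζ) ζ.contDiff hζs
  set n := 2 * (M + 1) with hn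
  have hn1 : (n:ℝ) = 2 * (M + 1) := by rw [hn]; push_cast; ring
  set κ := volume.real (Metric.closedBall (0:E3) 1) * δ ^ 3 * (δ ^ 3) ^ n with hκ
  have hκ0 : 0 < κ := by
    have : 0 < volume.real (Metric.closedBall (0:E3) 1) :=
      ENNReal.toReal_pos volume_unitBall_pos.ne' volume_unitBall_ne_top
    positivity
  refine ⟨R / 8, by positivity, R / (64 * (M + 3)), by positivity,
    n * (Z * C * volume.real (Metric.closedBall p (9 * R / 16))) / κ, fun r hr hr₀ F hF hsep => ?_⟩
  rw [le_div_iff₀ (by positivity)] at hr₀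
  have hMr : 0 ≤ (M:ℝ) * r := by positivity
  have hnr : (n:ℝ) * r ≤ R / 32 := by rw [hn1]; linarith
  have hrR : r ≤ R / 64 := by linarith
  set q := 288 * c * r ^ 2
  set w := increment φ q r with hw
  have hwc : Continuous w := continuous_increment h.continuous q r
  have hq0 : 0 ≤ q := by have := h.const_pos; positivity
  have hwle : ∀ y, dist y p ≤ 3 * R / 4 → w y ≤ C * r := by
    intro y hy
    obtain ⟨v, hv, e⟩ := exists_increment_eq h.continuous q hr.le y
    rw [hw, e]
    refine max_le (by positivity) ?_
    have h1 := (convex_ball p R).norm_image_sub_le_of_norm_fderiv_le (𝕜 := ℝ)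
      (fun z hz => (hd z hz).1) (fun z hz => (hd z hz).2) (x := y) (y := y + v)
      (by rw [Metric.mem_ball]; linarith) (by
        rw [Metric.mem_ball]
        have := dist_triangle (y + v) y p
        rw [dist_self_add_left] at this
        linarith)
    rw [add_sub_cancel_left] at h1
    have h2 : C * ‖v‖ ≤ C * r := by gcongr
    linarith [Real.le_norm_self (φ (y + v) - φ y)]
  have hmono : ∀ y, dist y p ≤ 3 * R / 4 → w y ≤ ballAvg r w y := fun y hy =>
    h.increment_le_ballAvg hr ((Metric.closedBall_subset_closedBall' (by linarith)).trans hU)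
  have hupper := integral_mul_iterate_ballAvg_sub_le hζc hζs hwc hr.le (hZ' r hr.le) (p := p)
    (S := 9 * R / 16) (B := C * r) (fun x hx => ζ.zero_of_le_dist (by
      change R / 2 ≤ dist x p
      linarith)) n (fun j hj x hx => by
      rw [abs_of_nonneg (iterate_ballAvg_nonneg (increment_nonneg φ q r) r j x)]
      refine iterate_ballAvg_le hwc hr.le hwle j ?_
      rw [Metric.mem_closedBall] at hx
      have : (j:ℝ) * r ≤ n * r := by gcongr
      linarith)
  set g : E3 → ℝ := fun x => ζ x * ((ballAvg r)^[n] w x - w x) with hg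
  have hgc : Continuous g := by
    have := continuous_iterate_ballAvg hwc r n
    fun_prop
  have hgi : Integrable g := hgc.integrable_of_hasCompactSupport hζs.mul_right
  have hg0 : ∀ x, 0 ≤ g x := by
    intro x
    by_cases hx : dist x p < R / 2
    · refine mul_nonneg ζ.nonneg (sub_nonneg.2 ?_)
      exact iterate_ballAvg_mono hwc hr.le hmono (Nat.zero_le n) (by linarith)
    · simp only [hg]
      rw [ζ.zero_of_le_dist (not_lt.1 hx), zero_mul]
  have hδr : δ * r ≤ r / 4 := by nlinarith
  have hball : ∀ x ∈ F, κ * r ^ 5 ≤ ∫ y in Metric.closedBall x (δ * r), g y := by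
    intro x hx
    obtain ⟨hx0, hxc, hxp⟩ := hF x hx
    have h1 : ∀ y ∈ Metric.closedBall x (δ * r), r ^ 2 * (δ ^ 3) ^ n ≤ g y := by
      intro y hy
      have h2 := h.le_iterate_ballAvg_increment hC hU (fun x hx => (hd x hx).1) hl hM1 hM' hδ hδ'
        hδC hr (by linarith) hx0 hxc hxp hy
      rw [Metric.mem_closedBall] at hy
      have h3 : w y = 0 := h.increment_eq_zero hr hx0 (by linarith)
        ((Metric.closedBall_subset_closedBall' (by linarith)).trans hU)
      simp only [hg]
      rw [ζ.one_of_mem_closedBall (by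
        rw [Metric.mem_closedBall]
        change dist y p ≤ R / 4
        linarith [dist_triangle y x p]), h3, one_mul, sub_zero]
      exact h2
    have h4 := setIntegral_ge_of_const_le_real Metric.isClosed_closedBall.measurableSet
      (isCompact_closedBall x (δ * r)).measure_lt_top.ne h1 hgi.integrableOn
    rw [Measure.addHaar_real_closedBall' _ _ (by positivity), finrank_E3] at h4
    refine le_trans (le_of_eq ?_) h4
    rw [hκ]
    ring
  have hsum : F.card * (κ * r ^ 5) ≤ ∫ x, g x := by
    calc F.card * (κ * r ^ 5) = ∑ x ∈ F, κ * r ^ 5 := by simp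
      _ ≤ ∑ x ∈ F, ∫ y in Metric.closedBall x (δ * r), g y := Finset.sum_le_sum hball
      _ = ∫ y in ⋃ x ∈ F, Metric.closedBall x (δ * r), g y := by
        refine (integral_biUnion_finset F
          (fun x _ => Metric.isClosed_closedBall.measurableSet) ?_
          fun x _ => hgi.integrableOn).symm
        intro x hx y hy hxy
        refine Metric.closedBall_disjoint_closedBall ?_
        linarith [hsep x hx y hy hxy]
      _ ≤ ∫ x, g x := setIntegral_le_integral hgi (Filter.Eventually.of_forall hg0)
  rw [le_div_iff₀ hκ0]
  have hr3 : 0 < r ^ 3 := by positivity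
  refine le_of_mul_le_mul_right ?_ hr3
  calc F.card * r ^ 2 * κ * r ^ 3 = F.card * (κ * r ^ 5) := by ring
    _ ≤ _ := hsum.trans hupper
    _ = _ := by ring

end ObstacleSolution

/-- A set whose separated subsets have at most quadratically many elements has finite
two-dimensional Hausdorff measure. -/
lemma hausdorffMeasure_two_lt_top_of_card_le {X : Type*} [MetricSpace X] [MeasurableSpace X]
    [BorelSpace X] {A : Set X} {r₀ C : ℝ} (hr₀ : 0 < r₀)
    (h : ∀ r, 0 < r → r ≤ r₀ → ∀ F : Finset X, (∀ x ∈ F, x ∈ A) →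
      (∀ x ∈ F, ∀ y ∈ F, x ≠ y → r < dist x y) → F.card * r ^ 2 ≤ C) :
    μH[2] A < ⊤ := by
  classical
  have hcover : ∀ r, 0 < r → r ≤ r₀ → ∃ F : Finset X, F.card * r ^ 2 ≤ C ∧
      A ⊆ ⋃ x : F, Metric.closedBall (x : X) r := by
    intro r hr hr'
    let P : ℕ → Prop := fun n => ∃ F : Finset X, F.card = n ∧ (∀ x ∈ F, x ∈ A) ∧
      ∀ x ∈ F, ∀ y ∈ F, x ≠ y → r < dist x y
    obtain ⟨N, hN⟩ := exists_nat_ge (C / r ^ 2)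
    have hbound : ∀ n, P n → n ≤ N := by
      rintro n ⟨F, rfl, hF, hsep⟩
      have := h r hr hr' F hF hsep
      rw [← le_div_iff₀ (by positivity)] at this
      exact_mod_cast this.trans hN
    obtain ⟨F, hcard, hF, hsep⟩ : P (Nat.findGreatest P N) :=
      Nat.findGreatest_spec (m := 0) (Nat.zero_le N) ⟨∅, by simp⟩
    refine ⟨F, h r hr hr' F hF hsep, fun x hx => ?_⟩
    by_contra hcon
    simp only [Set.mem_iUnion, Metric.mem_closedBall, not_exists, not_le, Subtype.forall] at hcon
    have hxF : x ∉ F := fun hxF => by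
      have := hcon x hxF
      rw [dist_self] at this
      linarith
    have hP : P (F.card + 1) := by
      refine ⟨insert x F, Finset.card_insert_of_notMem hxF, ?_, ?_⟩
      · simp only [Finset.mem_insert, forall_eq_or_imp]
        exact ⟨hx, hF⟩
      · intro y hy z hz hyz
        rw [Finset.mem_insert] at hy hz
        rcases hy with rfl | hy <;> rcases hz with rfl | hz
        · exact absurd rfl hyz
        · exact hcon z hz
        · rw [dist_comm]; exact hcon y hy
        · exact hsep y hy z hz hyz
    have := Nat.le_findGreatest (hbound _ hP) hP
    omega
  choose F hF hA using fun k : ℕ => hcover (r₀ / (k + 1)) (by positivity)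
    (div_le_self hr₀.le (by linarith [(Nat.cast_nonneg k : (0:ℝ) ≤ k)]))
  have hlim : Filter.Tendsto (fun k : ℕ => ENNReal.ofReal (2 * (r₀ / (k + 1)))) Filter.atTop
      (nhds 0) := by
    rw [← ENNReal.ofReal_zero]
    refine ENNReal.tendsto_ofReal ?_
    have := (tendsto_one_div_add_atTop_nhds_zero_nat (𝕜 := ℝ)).const_mul (2 * r₀)
    rw [mul_zero] at this
    exact this.congr fun k => by ring
  have hdiam : ∀ (k : ℕ) (x : X), Metric.ediam (Metric.closedBall x (r₀ / (k + 1)))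
      ≤ ENNReal.ofReal (2 * (r₀ / (k + 1))) := by
    intro k x
    refine Metric.ediam_le_of_forall_dist_le fun y hy z hz => ?_
    rw [Metric.mem_closedBall] at hy hz
    linarith [dist_triangle_right y z x]
  refine (Measure.hausdorffMeasure_le_liminf_sum 2 A _ hlim
    (fun k (x : F k) => Metric.closedBall (x : X) (r₀ / (k + 1)))
    (Filter.Eventually.of_forall fun k x => hdiam k x)
    (Filter.Eventually.of_forall hA)).trans_lt ?_
  refine lt_of_le_of_lt ?_ (ENNReal.ofReal_lt_top (r := 4 * C))
  refine Filter.liminf_le_of_le (by isBoundedDefault) fun b hb => ?_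
  obtain ⟨k, hk⟩ := hb.exists
  refine hk.trans ?_
  have hpos : 0 ≤ 2 * (r₀ / ((k:ℝ) + 1)) := by positivity
  calc ∑ x : F k, Metric.ediam (Metric.closedBall (x : X) (r₀ / (k + 1))) ^ (2:ℝ)
      ≤ ∑ _x : F k, ENNReal.ofReal ((2 * (r₀ / (k + 1))) ^ 2) := by
        refine Finset.sum_le_sum fun x _ => ?_
        rw [ENNReal.rpow_ofNat, ENNReal.ofReal_pow hpos]
        gcongr
        exact hdiam k x
    _ = ENNReal.ofReal (4 * ((F k).card * (r₀ / (k + 1)) ^ 2)) := by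
        rw [Finset.sum_const, Finset.card_univ, Fintype.card_coe, nsmul_eq_mul,
          ← ENNReal.ofReal_natCast, ← ENNReal.ofReal_mul (by positivity)]
        congr 1
        ring
    _ ≤ ENNReal.ofReal (4 * C) := by
        gcongr
        exact hF k

namespace ObstacleSolution

variable {φ : E3 → ℝ} {U : Set E3} {c : ℝ}

lemma hausdorffMeasure_lt_top (h : ObstacleSolution φ U c) {K : Set E3} (hK : IsCompact K)
    (hKU : K ⊆ U) : μH[2] (frontier (closure {x | 0 < φ x})ᶜ ∩ K) < ⊤ := by
  have hΓ : ∀ x ∈ frontier (closure {x | 0 < φ x})ᶜ, φ x = 0 ∧ x ∈ closure {x | 0 < φ x} := by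
    intro x hx
    rw [frontier_compl] at hx
    refine ⟨?_, isClosed_closure.frontier_subset hx⟩
    have h1 := frontier_closure_subset hx
    rw [(isOpen_lt continuous_const h.continuous).frontier_eq] at h1
    exact le_antisymm (not_lt.1 h1.2) (h.nonneg x)
  have hlocal : ∀ p ∈ K, ∃ V ∈ nhds p, μH[2] (frontier (closure {x | 0 < φ x})ᶜ ∩ V) < ⊤ := by
    intro p hp
    obtain ⟨R, hR, r₀, hr₀, C, hC⟩ := h.exists_card_mul_sq_le (hKU hp)
    refine ⟨Metric.closedBall p R, Metric.closedBall_mem_nhds p hR, ?_⟩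
    refine hausdorffMeasure_two_lt_top_of_card_le hr₀ (C := C) fun r hr hr' F hF hsep => ?_
    exact hC r hr hr' F (fun x hx => ⟨(hΓ x (hF x hx).1).1, (hΓ x (hF x hx).1).2, (hF x hx).2⟩) hsep
  choose! V hV hfin using hlocal
  obtain ⟨t, ht, htK⟩ := hK.elim_nhds_subcover V hV
  have hsub : frontier (closure {x | 0 < φ x})ᶜ ∩ K ⊆
      ⋃ p ∈ t, frontier (closure {x | 0 < φ x})ᶜ ∩ V p := by
    rw [← Set.inter_iUnion₂]
    exact Set.inter_subset_inter_right _ htK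
  refine (measure_mono hsub).trans_lt ?_
  exact measure_biUnion_lt_top t.finite_toSet fun p hp => hfin p (ht p hp)

end ObstacleSolution

/-- The difference between the Coulomb potential of a unit point charge and that of the same
charge smeared uniformly over the unit ball, at distance `s` from the centre. -/
def excess (s : ℝ) : ℝ := 1 / (4 * π * s) - 3 / (16 * π ^ 2) * ballPot s

lemma excess_of_le_one {s : ℝ} (hs : 0 < s) (hs1 : s ≤ 1) :
    excess s = (1 - s) ^ 2 * (2 + s) / (8 * π * s) := by
  have := Real.pi_pos
  rw [excess, ballPot, if_pos hs1]
  field_simp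
  ring

lemma excess_of_one_le {s : ℝ} (hs1 : 1 ≤ s) : excess s = 0 := by
  have := Real.pi_pos
  rcases hs1.eq_or_lt with rfl | hs
  · rw [excess_of_le_one one_pos le_rfl]; simp
  · rw [excess, ballPot, if_neg hs.not_ge]
    field_simp
    ring

lemma excess_nonneg {s : ℝ} (hs : 0 < s) : 0 ≤ excess s := by
  rcases le_total s 1 with h | h
  · rw [excess_of_le_one hs h]
    have := Real.pi_pos
    positivity
  · rw [excess_of_one_le h]

lemma excess_pos {s : ℝ} (hs : 0 < s) (hs1 : s < 1) : 0 < excess s := by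
  rw [excess_of_le_one hs hs1.le]
  have := Real.pi_pos
  have := sub_pos.2 hs1
  positivity

lemma ballPot_nonneg {s : ℝ} (hs : 0 ≤ s) : 0 ≤ ballPot s := by
  have := Real.pi_pos
  rw [ballPot]
  split_ifs with h
  · have : 0 ≤ 1 - s ^ 2 / 3 := by nlinarith
    positivity
  · positivity

lemma ballPot_le {s : ℝ} : ballPot s ≤ 2 * π := by
  have := Real.pi_pos
  rw [ballPot]
  split_ifs with h
  · nlinarith [sq_nonneg s]
  · push Not at h
    rw [div_le_iff₀ (by positivity)]
    nlinarith

lemma measurable_ballPot : Measurable ballPot := by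
  unfold ballPot
  exact Measurable.ite measurableSet_Iic (by fun_prop) (by fun_prop)

lemma coul_comm (x y : E3) : coul x y = coul y x := by
  rw [coul, coul, norm_sub_rev]

lemma coul_nonneg (x y : E3) : 0 ≤ coul x y := by
  have := Real.pi_pos
  rw [coul]
  positivity

lemma coul_eq_mul_inv (x y : E3) : coul x y = (4 * π)⁻¹ * ‖y - x‖⁻¹ := by
  rw [coul, norm_sub_rev, one_div, mul_inv]

lemma measurable_coul : Measurable fun p : E3 × E3 => coul p.1 p.2 := by
  unfold coul
  fun_prop

lemma coul_add_smul {r : ℝ} (hr : 0 < r) (x y z : E3) :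
    coul (x + r • z) y = r⁻¹ * (4 * π)⁻¹ * ‖z - r⁻¹ • (y - x)‖⁻¹ := by
  have : x + r • z - y = r • (z - r⁻¹ • (y - x)) := by
    rw [smul_sub, smul_inv_smul₀ hr.ne']
    abel
  rw [coul, this, norm_smul, Real.norm_of_nonneg hr.le, one_div]
  simp only [mul_inv]
  ring

lemma integrableOn_unitBall (w : E3) :
    IntegrableOn (fun z => ‖z - w‖⁻¹) (Metric.closedBall (0:E3) 1) := by
  refine ⟨by fun_prop, ?_⟩
  rw [hasFiniteIntegral_iff_ofReal (Filter.Eventually.of_forall fun z => by positivity),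
    lintegral_unitBall_eq]
  exact ENNReal.ofReal_lt_top

lemma integral_unitBall_eq (w : E3) :
    ∫ z in Metric.closedBall (0:E3) 1, ‖z - w‖⁻¹ = ballPot ‖w‖ := by
  rw [integral_eq_lintegral_of_nonneg_ae (Filter.Eventually.of_forall fun z => by positivity)
    (by fun_prop), lintegral_unitBall_eq, ENNReal.toReal_ofReal (ballPot_nonneg (norm_nonneg _))]

lemma volume_unitBall : (volume (Metric.closedBall (0:E3) 1)).toReal = 4 * π / 3 := by
  rw [EuclideanSpace.volume_closedBall_fin_three, ENNReal.toReal_mul, ENNReal.toReal_pow]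
  rw [ENNReal.toReal_ofReal zero_le_one, ENNReal.toReal_ofReal (by positivity)]
  ring

lemma integrable_coul_add_smul {r : ℝ} (hr : 0 < r) (x y : E3) :
    Integrable (fun z => coul (x + r • z) y) uball := by
  simp only [coul_add_smul hr]
  exact ((integrableOn_unitBall _).integrable.const_mul _).smul_measure
    (ENNReal.inv_ne_top.2 volume_unitBall_pos.ne')

lemma ballAvg_coul {r : ℝ} (hr : 0 < r) (x y : E3) :
    ballAvg r (fun w => coul w y) x = coul x y - r⁻¹ * excess (‖y - x‖ / r) := by
  have := Real.pi_pos
  simp only [ballAvg, coul_add_smul hr, integral_const_mul]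
  rw [uball, integral_smul_measure, integral_unitBall_eq, ENNReal.toReal_inv, volume_unitBall,
    norm_smul, excess, coul_eq_mul_inv, norm_inv, Real.norm_of_nonneg hr.le, smul_eq_mul,
    div_eq_inv_mul]
  field_simp
  ring

lemma integrableOn_coul (x a : E3) (r : ℝ) : IntegrableOn (coul x) (Metric.closedBall a r) := by
  wlog hr : 0 < r generalizing r
  · exact (this 1 one_pos).mono_set (Metric.closedBall_subset_closedBall (by linarith))
  have h := (integrable_coul_add_smul hr a x)
  rw [uball, integrable_smul_measure (ENNReal.inv_ne_zero.2 volume_unitBall_ne_top)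
    (ENNReal.inv_ne_top.2 volume_unitBall_pos.ne')] at h
  have h1 : IntegrableOn (fun z => coul (a + r • z) x) (Metric.closedBall (0:E3) 1) := h
  rw [← integrable_indicator_iff Metric.isClosed_closedBall.measurableSet] at h1 ⊢
  have h2 : (Metric.closedBall (0:E3) 1).indicator (fun z => coul (a + r • z) x)
      = fun z => (fun y => (Metric.closedBall a r).indicator (coul x) (a + y)) (r • z) := by
    ext z
    have hz := add_smul_mem_closedBall_iff hr a z
    change _ = (Metric.closedBall a r).indicator (coul x) (a + r • z)
    by_cases h : z ∈ Metric.closedBall (0:E3) 1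
    · rw [Set.indicator_of_mem h, Set.indicator_of_mem (hz.2 h), coul_comm]
    · rw [Set.indicator_of_notMem h, Set.indicator_of_notMem (fun h' => h (hz.1 h'))]
  rw [h2, integrable_comp_smul_iff volume
    (fun y => (Metric.closedBall a r).indicator (coul x) (a + y)) hr.ne'] at h1
  simpa using h1.comp_add_left (-a)

lemma setIntegral_coul_le (x a : E3) {r : ℝ} (hr : 0 < r) :
    ∫ y in Metric.closedBall a r, coul x y ≤ r ^ 2 / 2 := by
  have := Real.pi_pos
  have h := ballAvg_eq_setIntegral (fun w => coul w x) hr a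
  simp only [ballAvg, coul_add_smul hr, integral_const_mul] at h
  rw [uball, integral_smul_measure, integral_unitBall_eq, ENNReal.toReal_inv, volume_unitBall,
    smul_eq_mul] at h
  simp only [coul_comm _ x] at h
  have h1 : ∫ y in Metric.closedBall a r, coul x y
      = r ^ 2 * (4 * π)⁻¹ * ballPot ‖r⁻¹ • (x - a)‖ := by
    field_simp at h ⊢
    linarith
  rw [h1]
  calc r ^ 2 * (4 * π)⁻¹ * ballPot ‖r⁻¹ • (x - a)‖ ≤ r ^ 2 * (4 * π)⁻¹ * (2 * π) := by
        gcongr; exact ballPot_le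
    _ = r ^ 2 / 2 := by field_simp; ring

/-- The kernel measuring how much a potential exceeds its average over a ball of radius `r`. -/
def excessKernel (r : ℝ) (x y : E3) : ℝ := r⁻¹ * excess (‖y - x‖ / r)

lemma measurable_excessKernel (r : ℝ) (x : E3) : Measurable (excessKernel r x) := by
  unfold excessKernel excess
  have := measurable_ballPot
  fun_prop

lemma excessKernel_eq_zero {r : ℝ} (hr : 0 < r) {x y : E3} (h : y ∉ Metric.closedBall x r) :
    excessKernel r x y = 0 := by
  rw [mem_closedBall_iff_norm, not_le] at h
  rw [excessKernel, excess_of_one_le ((one_le_div hr).2 h.le), mul_zero]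

lemma excessKernel_nonneg {r : ℝ} (hr : 0 < r) {x y : E3} (h : y ≠ x) :
    0 ≤ excessKernel r x y := by
  have := norm_pos_iff.2 (sub_ne_zero.2 h)
  exact mul_nonneg (by positivity) (excess_nonneg (by positivity))

lemma excessKernel_le_coul {r : ℝ} (hr : 0 < r) (x y : E3) : excessKernel r x y ≤ coul x y := by
  have h := ballAvg_coul hr x y
  have h1 : 0 ≤ ballAvg r (fun w => coul w y) x := integral_nonneg fun z => coul_nonneg _ _
  rw [excessKernel]
  linarith

lemma ae_excessKernel_nonneg {r : ℝ} (hr : 0 < r) (x : E3) :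
    ∀ᵐ y, 0 ≤ excessKernel r x y := by
  filter_upwards [compl_mem_ae_iff.2 (measure_singleton x)] with y hy
  exact excessKernel_nonneg hr hy

lemma integrable_excessKernel {r : ℝ} (hr : 0 < r) (x : E3) : Integrable (excessKernel r x) := by
  have h : IntegrableOn (excessKernel r x) (Metric.closedBall x r) := by
    refine (integrableOn_coul x x r).mono' (measurable_excessKernel r x).aestronglyMeasurable ?_
    filter_upwards [ae_restrict_of_ae (ae_excessKernel_nonneg hr x)] with y hy
    rw [Real.norm_of_nonneg hy]
    exact excessKernel_le_coul hr x y
  exact h.integrable_of_forall_notMem_eq_zero fun y hy => excessKernel_eq_zero hr hy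

/-- The mass of the excess kernel at unit scale. -/
def excessMass : ℝ := ∫ z, excessKernel 1 0 z

lemma excessMass_pos : 0 < excessMass := by
  rw [excessMass, integral_pos_iff_support_of_nonneg_ae (ae_excessKernel_nonneg one_pos 0)
    (integrable_excessKernel one_pos 0)]
  have h : Metric.ball (0:E3) 1 \ {0} ⊆ Function.support (excessKernel 1 0) := by
    intro z hz
    have hz0 : 0 < ‖z‖ := norm_pos_iff.2 hz.2
    have hz1 : ‖z‖ < 1 := mem_ball_zero_iff.1 hz.1
    have := excess_pos hz0 hz1
    simp [excessKernel, this.ne']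
  refine lt_of_lt_of_le ?_ (measure_mono h)
  rw [measure_sdiff_null (measure_singleton _)]
  exact Metric.measure_ball_pos _ _ one_pos

lemma integral_excessKernel {r : ℝ} (hr : 0 < r) (x : E3) :
    ∫ y, excessKernel r x y = excessMass * r ^ 2 := by
  have h1 : ∀ y, excessKernel r x y = r⁻¹ * excessKernel 1 0 (r⁻¹ • (y - x)) := by
    intro y
    simp only [excessKernel, sub_zero, norm_smul, norm_inv, Real.norm_of_nonneg hr.le,
      inv_one, one_mul, div_eq_inv_mul]
  simp only [h1, integral_const_mul]
  rw [integral_sub_right_eq_self (fun y => excessKernel 1 0 (r⁻¹ • y)) x,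
    Measure.integral_comp_smul, finrank_E3, smul_eq_mul, ← excessMass, abs_of_pos (by positivity)]
  field_simp

/-- The Coulomb potential of the charge density `u`. -/
def newtonPot (u : E3 → ℝ) (x : E3) : ℝ := ∫ y, u y * coul x y

/-- The Coulomb kernel truncated at distance `ε` from the singularity. -/
def truncCoul (ε : ℝ) (x y : E3) : ℝ := 1 / (4 * π * max ‖x - y‖ ε)

lemma truncCoul_nonneg {ε : ℝ} (x y : E3) : 0 ≤ truncCoul ε x y := by
  have := Real.pi_pos
  have : 0 ≤ max ‖x - y‖ ε := le_max_of_le_left (norm_nonneg _)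
  rw [truncCoul]
  positivity

lemma truncCoul_le {ε : ℝ} (hε : 0 < ε) (x y : E3) : truncCoul ε x y ≤ (4 * π * ε)⁻¹ := by
  have := Real.pi_pos
  rw [truncCoul, one_div]
  gcongr
  exact le_max_right _ _

lemma continuous_truncCoul {ε : ℝ} (hε : 0 < ε) : Continuous fun p : E3 × E3 =>
    truncCoul ε p.1 p.2 := by
  have := Real.pi_pos
  have h : ∀ p : E3 × E3, 4 * π * max ‖p.1 - p.2‖ ε ≠ 0 := fun p => by
    have : 0 < max ‖p.1 - p.2‖ ε := lt_max_of_lt_right hε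
    positivity
  unfold truncCoul
  exact continuous_const.div (by fun_prop) h

lemma abs_coul_sub_truncCoul_le {ε : ℝ} {x y : E3} (hxy : y ≠ x) :
    |coul x y - truncCoul ε x y| ≤ (Metric.closedBall x ε).indicator (coul x) y := by
  have := Real.pi_pos
  by_cases h : y ∈ Metric.closedBall x ε
  · have hpos : 0 < ‖x - y‖ := norm_pos_iff.2 (sub_ne_zero.2 hxy.symm)
    have h1 : truncCoul ε x y ≤ coul x y := by
      rw [truncCoul, coul]
      gcongr
      exact le_max_left _ _
    rw [Set.indicator_of_mem h, abs_of_nonneg (sub_nonneg.2 h1)]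
    linarith [truncCoul_nonneg (ε := ε) x y]
  · rw [Set.indicator_of_notMem h]
    rw [mem_closedBall_iff_norm', not_le] at h
    rw [coul, truncCoul, max_eq_left h.le, sub_self, abs_zero]

lemma ae_ne_point (x : E3) : ∀ᵐ y : E3, y ≠ x := compl_mem_ae_iff.2 (measure_singleton x)

lemma norm_mul_truncCoul_le {ε : ℝ} (hε : 0 < ε) (u : E3 → ℝ) (x y : E3) :
    ‖u y * truncCoul ε x y‖ ≤ |u y| * (4 * π * ε)⁻¹ := by
  rw [norm_mul, Real.norm_of_nonneg (truncCoul_nonneg x y), Real.norm_eq_abs]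
  exact mul_le_mul_of_nonneg_left (truncCoul_le hε x y) (abs_nonneg _)

lemma aestronglyMeasurable_mul_truncCoul {u : E3 → ℝ} (hu : Integrable u) {ε : ℝ} (hε : 0 < ε)
    (x : E3) : AEStronglyMeasurable fun y => u y * truncCoul ε x y :=
  hu.aestronglyMeasurable.mul ((continuous_truncCoul hε).comp
    (by fun_prop : Continuous fun y : E3 => (x, y))).aestronglyMeasurable

lemma integrable_mul_truncCoul {u : E3 → ℝ} (hu : Integrable u) {ε : ℝ} (hε : 0 < ε) (x : E3) :
    Integrable fun y => u y * truncCoul ε x y :=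
  (hu.abs.mul_const _).mono' (aestronglyMeasurable_mul_truncCoul hu hε x)
    (Filter.Eventually.of_forall fun y => norm_mul_truncCoul_le hε u x y)

lemma continuous_truncPot {u : E3 → ℝ} (hu : Integrable u) {ε : ℝ} (hε : 0 < ε) :
    Continuous fun x => ∫ y, u y * truncCoul ε x y := by
  refine continuous_of_dominated (aestronglyMeasurable_mul_truncCoul hu hε)
    (fun x => Filter.Eventually.of_forall fun y => norm_mul_truncCoul_le hε u x y)
    (hu.abs.mul_const _) (Filter.Eventually.of_forall fun y => ?_)
  have h : Continuous fun x => truncCoul ε x y :=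
    (continuous_truncCoul hε).comp (g := fun p : E3 × E3 => truncCoul ε p.1 p.2)
      (f := fun x => (x, y)) (by fun_prop)
  exact continuous_const.mul h

lemma tendsto_truncCoul (ε : ℝ) (y : E3) :
    Filter.Tendsto (fun x => truncCoul ε x y) (Filter.cocompact E3) (nhds 0) := by
  have h : Filter.Tendsto (fun x : E3 => ‖x - y‖) (Filter.cocompact E3) Filter.atTop := by
    simpa [dist_eq_norm] using tendsto_dist_right_cocompact_atTop (α := E3) y
  have h1 : Filter.Tendsto (fun x : E3 => 4 * π * max ‖x - y‖ ε) (Filter.cocompact E3)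
      Filter.atTop :=
    (Filter.tendsto_atTop_mono (fun x => le_max_left _ _) h).const_mul_atTop
      (by have := Real.pi_pos; positivity)
  exact tendsto_const_nhds.div_atTop h1

lemma tendsto_truncPot {u : E3 → ℝ} (hu : Integrable u) {ε : ℝ} (hε : 0 < ε) :
    Filter.Tendsto (fun x => ∫ y, u y * truncCoul ε x y) (Filter.cocompact E3) (nhds 0) := by
  have : (Filter.cocompact E3).IsCountablyGenerated := by
    rw [← Metric.cobounded_eq_cocompact, ← comap_norm_atTop]
    infer_instance
  have h := tendsto_integral_filter_of_dominated_convergence (μ := volume)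
    (l := Filter.cocompact E3) (F := fun x y => u y * truncCoul ε x y) (f := fun _ => 0)
    (fun y => |u y| * (4 * π * ε)⁻¹)
    (Filter.Eventually.of_forall (aestronglyMeasurable_mul_truncCoul hu hε))
    (Filter.Eventually.of_forall fun x =>
      Filter.Eventually.of_forall fun y => norm_mul_truncCoul_le hε u x y)
    (hu.abs.mul_const _) (Filter.Eventually.of_forall fun y => by
      simpa using (tendsto_truncCoul ε y).const_mul (u y))
  simpa using h

lemma ae_norm_mul_coul_sub_le {u : E3 → ℝ} (hb : ∀ y, |u y| ≤ 1) (ε : ℝ) (x : E3) :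
    ∀ᵐ y, ‖u y * (coul x y - truncCoul ε x y)‖
      ≤ (Metric.closedBall x ε).indicator (coul x) y := by
  filter_upwards [ae_ne_point x] with y hy
  rw [norm_mul]
  exact (mul_le_of_le_one_left (norm_nonneg _) (hb y)).trans (abs_coul_sub_truncCoul_le hy)

lemma integrable_mul_coul_sub {u : E3 → ℝ} (hu : Integrable u) (hb : ∀ y, |u y| ≤ 1) (ε : ℝ)
    (x : E3) : Integrable fun y => u y * (coul x y - truncCoul ε x y) := by
  refine ((integrable_indicator_iff Metric.isClosed_closedBall.measurableSet).2
    (integrableOn_coul x x ε)).mono' ?_ (ae_norm_mul_coul_sub_le hb ε x)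
  have h1 : Measurable (coul x) := by
    unfold coul
    fun_prop
  have h2 : Measurable (truncCoul ε x) := by
    unfold truncCoul
    fun_prop
  exact hu.aestronglyMeasurable.mul (h1.sub h2).aestronglyMeasurable

lemma integrable_mul_coul {u : E3 → ℝ} (hu : Integrable u) (hb : ∀ y, |u y| ≤ 1) (x : E3) :
    Integrable fun y => u y * coul x y := by
  refine ((integrable_mul_coul_sub hu hb 1 x).add
    (integrable_mul_truncCoul hu one_pos x)).congr (Filter.Eventually.of_forall fun y => ?_)
  simp only [Pi.add_apply]
  ring

lemma abs_newtonPot_sub_le {u : E3 → ℝ} (hu : Integrable u) (hb : ∀ y, |u y| ≤ 1) {ε : ℝ}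
    (hε : 0 < ε) (x : E3) :
    |newtonPot u x - ∫ y, u y * truncCoul ε x y| ≤ ε ^ 2 / 2 := by
  rw [newtonPot, ← integral_sub (integrable_mul_coul hu hb x) (integrable_mul_truncCoul hu hε x)]
  simp only [← mul_sub]
  refine (norm_integral_le_of_norm_le ((integrable_indicator_iff
    Metric.isClosed_closedBall.measurableSet).2 (integrableOn_coul x x ε))
    (ae_norm_mul_coul_sub_le hb ε x)).trans ?_
  rw [integral_indicator Metric.isClosed_closedBall.measurableSet]
  exact setIntegral_coul_le x x hε

lemma exists_abs_newtonPot_sub_lt {u : E3 → ℝ} (hu : Integrable u) (hb : ∀ y, |u y| ≤ 1) {δ : ℝ}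
    (hδ : 0 < δ) :
    ∃ ε > 0, ∀ x, |newtonPot u x - ∫ y, u y * truncCoul ε x y| < δ := by
  refine ⟨√δ, Real.sqrt_pos.2 hδ, fun x => ?_⟩
  refine (abs_newtonPot_sub_le hu hb (Real.sqrt_pos.2 hδ) x).trans_lt ?_
  rw [Real.sq_sqrt hδ.le]
  linarith

lemma continuous_newtonPot {u : E3 → ℝ} (hu : Integrable u) (hb : ∀ y, |u y| ≤ 1) :
    Continuous (newtonPot u) := by
  refine continuous_of_uniform_approx_of_continuous fun s hs => ?_
  obtain ⟨δ, hδ, hs⟩ := Metric.mem_uniformity_dist.1 hs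
  obtain ⟨ε, hε, h⟩ := exists_abs_newtonPot_sub_lt hu hb hδ
  exact ⟨_, continuous_truncPot hu hε, fun x => hs (h x)⟩

lemma tendsto_newtonPot {u : E3 → ℝ} (hu : Integrable u) (hb : ∀ y, |u y| ≤ 1) :
    Filter.Tendsto (newtonPot u) (Filter.cocompact E3) (nhds 0) := by
  rw [Metric.tendsto_nhds]
  intro δ hδ
  obtain ⟨ε, hε, h⟩ := exists_abs_newtonPot_sub_lt hu hb (half_pos hδ)
  filter_upwards [Metric.tendsto_nhds.1 (tendsto_truncPot hu hε) (δ / 2) (half_pos hδ)] with x hx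
  have h1 := h x
  rw [Real.dist_eq, sub_zero] at hx ⊢
  rw [abs_lt] at *
  constructor <;> linarith

lemma exists_abs_newtonPot_le {u : E3 → ℝ} (hu : Integrable u) (hb : ∀ y, |u y| ≤ 1) :
    ∃ C, ∀ x, |newtonPot u x| ≤ C := by
  refine ⟨1 ^ 2 / 2 + ∫ y, |u y| * (4 * π * 1)⁻¹, fun x => ?_⟩
  have h1 := abs_newtonPot_sub_le hu hb one_pos x
  have h2 : ‖∫ y, u y * truncCoul 1 x y‖ ≤ ∫ y, |u y| * (4 * π * 1)⁻¹ :=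
    norm_integral_le_of_norm_le (hu.abs.mul_const _)
      (Filter.Eventually.of_forall fun y => norm_mul_truncCoul_le one_pos u x y)
  rw [Real.norm_eq_abs] at h2
  rw [abs_le] at *
  constructor <;> linarith

lemma newtonPot_sub {u v : E3 → ℝ} (hu : Integrable u) (hub : ∀ y, |u y| ≤ 1)
    (hv : Integrable v) (hvb : ∀ y, |v y| ≤ 1) (x : E3) :
    newtonPot (fun y => u y - v y) x = newtonPot u x - newtonPot v x := by
  simp only [newtonPot, sub_mul]
  exact integral_sub (integrable_mul_coul hu hub x) (integrable_mul_coul hv hvb x)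

lemma integrable_mul_excessKernel {u : E3 → ℝ} (hu : Integrable u) (hb : ∀ y, |u y| ≤ 1) {r : ℝ}
    (hr : 0 < r) (x : E3) : Integrable fun y => u y * excessKernel r x y :=
  (integrable_excessKernel hr x).bdd_mul hu.aestronglyMeasurable
    (Filter.Eventually.of_forall hb)

lemma ballAvg_newtonPot {u : E3 → ℝ} (hu : Integrable u) (hb : ∀ y, |u y| ≤ 1) {r : ℝ}
    (hr : 0 < r) (x : E3) :
    ballAvg r (newtonPot u) x = newtonPot u x - ∫ y, u y * excessKernel r x y := by
  have hmeas : AEStronglyMeasurable (fun p : E3 × E3 => u p.2 * coul (x + r • p.1) p.2)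
      (uball.prod volume) := by
    refine hu.aestronglyMeasurable.comp_snd.mul ?_
    exact (measurable_coul.comp (by fun_prop : Measurable fun p : E3 × E3 =>
      (x + r • p.1, p.2))).aestronglyMeasurable
  have havg : ∀ y, ∫ z, coul (x + r • z) y ∂uball = coul x y - excessKernel r x y :=
    fun y => ballAvg_coul hr x y
  have hint : Integrable (fun p : E3 × E3 => u p.2 * coul (x + r • p.1) p.2)
      (uball.prod volume) := by
    rw [integrable_prod_iff' hmeas]
    refine ⟨Filter.Eventually.of_forall fun y =>
      (integrable_coul_add_smul hr x y).const_mul (u y), ?_⟩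
    simp only [norm_mul, integral_const_mul, Real.norm_of_nonneg (coul_nonneg _ _), havg, mul_sub]
    exact (integrable_mul_coul hu.norm (by simpa using hb) x).sub
      (integrable_mul_excessKernel hu.norm (by simpa using hb) hr x)
  have hswap := integral_integral_swap (f := fun z y => u y * coul (x + r • z) y) hint
  simp only [integral_const_mul, havg, mul_sub] at hswap
  rw [integral_sub (integrable_mul_coul hu hb x) (integrable_mul_excessKernel hu hb hr x)] at hswap
  exact hswap

/-- The Coulomb potential of a unit charge density on `A`. -/
def setPot (A : Set E3) : E3 → ℝ := newtonPot (A.indicator fun _ => (1:ℝ))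

lemma abs_indicator_one_le (A : Set E3) (y : E3) : |A.indicator (fun _ => (1:ℝ)) y| ≤ 1 := by
  by_cases h : y ∈ A <;> simp [h]

lemma integrable_indicator_one {A : Set E3} (hA : MeasurableSet A) (hf : volume A < ⊤) :
    Integrable (A.indicator fun _ => (1:ℝ)) :=
  (integrable_indicator_iff hA).2 (integrableOn_const hf.ne)

lemma indicator_one_mul (A : Set E3) (f : E3 → ℝ) :
    (fun y => A.indicator (fun _ => (1:ℝ)) y * f y) = A.indicator f := by
  ext y
  by_cases h : y ∈ A <;> simp [h]

lemma setPot_eq_setIntegral {A : Set E3} (hA : MeasurableSet A) (x : E3) :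
    setPot A x = ∫ y in A, coul x y := by
  rw [setPot, newtonPot, indicator_one_mul, integral_indicator hA]

lemma integrableOn_coul_of_finite {A : Set E3} (hA : MeasurableSet A) (hf : volume A < ⊤)
    (x : E3) : IntegrableOn (coul x) A := by
  have h := integrable_mul_coul (integrable_indicator_one hA hf) (abs_indicator_one_le A) x
  rwa [indicator_one_mul, integrable_indicator_iff hA] at h

lemma continuous_setPot {A : Set E3} (hA : MeasurableSet A) (hf : volume A < ⊤) :
    Continuous (setPot A) :=
  continuous_newtonPot (integrable_indicator_one hA hf) (abs_indicator_one_le A)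

lemma integrableOn_setPot {A B : Set E3} (hA : MeasurableSet A) (hAf : volume A < ⊤)
    (hBf : volume B < ⊤) : IntegrableOn (setPot A) B := by
  obtain ⟨C, hC⟩ := exists_abs_newtonPot_le (integrable_indicator_one hA hAf)
    (abs_indicator_one_le A)
  exact IntegrableOn.of_bound hBf (continuous_setPot hA hAf).aestronglyMeasurable C
    (Filter.Eventually.of_forall hC)

/-- The mutual Coulomb energy of unit charge densities on `A` and `B`. -/
def interaction (A B : Set E3) : ℝ := ∫ x in A, setPot B x

lemma energy_eq {A B : Set E3} (hA : MeasurableSet A) (hB : MeasurableSet B) :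
    energy A B = interaction A A + interaction B B - 2 * interaction A B := by
  simp only [energy, interaction, setPot_eq_setIntegral hA, setPot_eq_setIntegral hB]

lemma interaction_comm {A B : Set E3} (hA : MeasurableSet A) (hAf : volume A < ⊤)
    (hB : MeasurableSet B) (hBf : volume B < ⊤) : interaction A B = interaction B A := by
  have hint : Integrable (fun p : E3 × E3 => coul p.1 p.2)
      ((volume.restrict A).prod (volume.restrict B)) := by
    rw [integrable_prod_iff measurable_coul.aestronglyMeasurable]
    refine ⟨Filter.Eventually.of_forall (integrableOn_coul_of_finite hB hBf), ?_⟩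
    have h : ∀ x, ∫ y in B, ‖coul x y‖ = setPot B x := fun x => by
      simp only [Real.norm_of_nonneg (coul_nonneg _ _),
        setPot_eq_setIntegral hB]
    simp only [h]
    exact integrableOn_setPot hB hBf hAf
  have h := integral_integral_swap (f := coul) hint
  simp only [interaction, setPot_eq_setIntegral hA, setPot_eq_setIntegral hB]
  rw [h]
  simp only [coul_comm]

lemma interaction_union_left {A B C : Set E3} (hB : MeasurableSet B) (hd : Disjoint A B)
    (hAf : volume A < ⊤) (hBf : volume B < ⊤) (hC : MeasurableSet C) (hCf : volume C < ⊤) :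
    interaction (A ∪ B) C = interaction A C + interaction B C :=
  setIntegral_union hd hB (integrableOn_setPot hC hCf hAf) (integrableOn_setPot hC hCf hBf)

lemma interaction_union_right {A B C : Set E3} (hA : MeasurableSet A) (hB : MeasurableSet B)
    (hd : Disjoint A B) (hAf : volume A < ⊤) (hBf : volume B < ⊤) (hC : MeasurableSet C)
    (hCf : volume C < ⊤) : interaction C (A ∪ B) = interaction C A + interaction C B := by
  have hf : volume (A ∪ B) < ⊤ := measure_union_lt_top hAf hBf
  rw [interaction_comm hC hCf (hA.union hB) hf, interaction_union_left hB hd hAf hBf hC hCf,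
    interaction_comm hA hAf hC hCf, interaction_comm hB hBf hC hCf]

lemma energy_union {P A D : Set E3} (hP : MeasurableSet P) (hPf : volume P < ⊤)
    (hA : MeasurableSet A) (hAf : volume A < ⊤) (hD : MeasurableSet D) (hDf : volume D < ⊤)
    (hd : Disjoint A D) :
    energy P (A ∪ D) = energy P A + 2 * interaction D A - 2 * interaction D P
      + interaction D D := by
  have hf : volume (A ∪ D) < ⊤ := measure_union_lt_top hAf hDf
  rw [energy_eq hP (hA.union hD), energy_eq hP hA,
    interaction_union_right hA hD hd hAf hDf (hA.union hD) hf,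
    interaction_union_left hD hd hAf hDf hA hAf, interaction_union_left hD hd hAf hDf hD hDf,
    interaction_union_right hA hD hd hAf hDf hP hPf, interaction_comm hA hAf hD hDf,
    interaction_comm hD hDf hP hPf]
  ring

lemma potential_eq {P A : Set E3} (hP : MeasurableSet P) (hPf : volume P < ⊤)
    (hA : MeasurableSet A) (hAf : volume A < ⊤) (x : E3) :
    potential P A x = setPot P x - setPot A x :=
  newtonPot_sub (integrable_indicator_one hP hPf) (abs_indicator_one_le P)
    (integrable_indicator_one hA hAf) (abs_indicator_one_le A) x

lemma setIntegral_potential {P A D : Set E3} (hP : MeasurableSet P) (hPf : volume P < ⊤)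
    (hA : MeasurableSet A) (hAf : volume A < ⊤) (hDf : volume D < ⊤) :
    ∫ x in D, potential P A x = interaction D P - interaction D A := by
  simp only [potential_eq hP hPf hA hAf]
  exact integral_sub (integrableOn_setPot hP hPf hDf) (integrableOn_setPot hA hAf hDf)

lemma setPot_le {D : Set E3} (hD : MeasurableSet D) {a : E3} {r : ℝ} (hr : 0 < r)
    (hDr : D ⊆ Metric.closedBall a r) (x : E3) : setPot D x ≤ r ^ 2 / 2 := by
  rw [setPot_eq_setIntegral hD]
  refine (setIntegral_mono_set (integrableOn_coul x a r)
    (Filter.Eventually.of_forall fun y => coul_nonneg x y) hDr.eventuallyLE).trans ?_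
  exact setIntegral_coul_le x a hr

lemma interaction_self_le {D : Set E3} (hD : MeasurableSet D) {a : E3} {r : ℝ} (hr : 0 < r)
    (hDr : D ⊆ Metric.closedBall a r) : interaction D D ≤ r ^ 2 / 2 * volume.real D := by
  have hDf : volume D < ⊤ := (measure_mono hDr).trans_lt measure_closedBall_lt_top
  have h := setIntegral_mono (μ := volume) (integrableOn_setPot hD hDf hDf)
    (integrableOn_const (C := r ^ 2 / 2) hDf.ne) (setPot_le hD hr hDr)
  rw [setIntegral_const, smul_eq_mul, mul_comm] at h
  exact h

lemma measure_inter_pos_eq_zero {g : E3 → ℝ} (hg : Continuous g) {S : Set E3}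
    (hS : MeasurableSet S) (h : ∀ D ⊆ S, MeasurableSet D → volume D < ⊤ →
      2 * ∫ x in D, g x ≤ interaction D D) : volume (S ∩ {x | 0 < g x}) = 0 := by
  refine measure_null_of_locally_null _ fun a ha => ?_
  have hga : 0 < g a := ha.2
  obtain ⟨s, hs, hball⟩ := Metric.nhds_basis_closedBall.mem_iff.1
    (hg.continuousAt.eventually_const_lt (half_lt_self hga))
  let r := min s √(g a)
  have hr : 0 < r := lt_min hs (Real.sqrt_pos.2 hga)
  have hr2 : r ^ 2 ≤ g a :=
    (pow_le_pow_left₀ hr.le (min_le_right _ _) 2).trans_eq (Real.sq_sqrt hga.le)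
  let D := S ∩ Metric.closedBall a r
  have hD : MeasurableSet D := hS.inter Metric.isClosed_closedBall.measurableSet
  have hDr : D ⊆ Metric.closedBall a r := Set.inter_subset_right
  have hDf : volume D < ⊤ := (measure_mono hDr).trans_lt measure_closedBall_lt_top
  have hlow : g a / 2 * volume.real D ≤ ∫ x in D, g x := by
    refine setIntegral_ge_of_const_le_real hD hDf.ne (fun x hx => le_of_lt ?_) ?_
    · exact hball (Metric.closedBall_subset_closedBall (min_le_left _ _) (hDr hx))
    · exact (hg.continuousOn.integrableOn_compact (isCompact_closedBall a r)).mono_set hDr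
  have hD0 : volume.real D = 0 := by
    have h1 := h D Set.inter_subset_left hD hDf
    have h2 := interaction_self_le hD hr hDr
    have h3 : r ^ 2 / 2 * volume.real D ≤ g a / 2 * volume.real D := by gcongr
    nlinarith [measureReal_nonneg (μ := volume) (s := D)]
  refine ⟨D ∩ {x | 0 < g x}, ?_, measure_mono_null Set.inter_subset_left
    ((measureReal_eq_zero_iff hDf.ne).1 hD0)⟩
  rw [show D ∩ {x | 0 < g x} = Metric.closedBall a r ∩ (S ∩ {x | 0 < g x}) by
    simp only [D, Set.inter_comm S, Set.inter_assoc]]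
  exact Filter.inter_mem (mem_nhdsWithin_of_mem_nhds (Metric.closedBall_mem_nhds a hr))
    self_mem_nhdsWithin

/-- `A` minimizes the Coulomb energy among the admissible sets for the bounded open set `P`. -/
structure IsMinimizer (P A : Set E3) : Prop where
  isOpen : IsOpen P
  isBounded : Bornology.IsBounded P
  adm : Adm P A
  energy_le : ∀ B, Adm P B → energy P A ≤ energy P B

namespace IsMinimizer

variable {P A : Set E3}

lemma measurableSet_left (h : IsMinimizer P A) : MeasurableSet P := h.isOpen.measurableSet

lemma measurableSet_right (h : IsMinimizer P A) : MeasurableSet A := h.adm.1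

lemma volume_left (h : IsMinimizer P A) : volume P < ⊤ := h.isBounded.measure_lt_top

lemma volume_right (h : IsMinimizer P A) : volume A < ⊤ := h.adm.2.2

lemma setIntegral_neg_potential_le (h : IsMinimizer P A) {D : Set E3} (hDA : D ⊆ A)
    (hD : MeasurableSet D) (hDf : volume D < ⊤) :
    2 * ∫ x in D, -potential P A x ≤ interaction D D := by
  have hR : MeasurableSet (A \ D) := h.measurableSet_right.diff hD
  have hRf : volume (A \ D) < ⊤ := (measure_mono Set.sdiff_subset).trans_lt h.volume_right
  have hle := h.energy_le (A \ D) ⟨hR, measure_mono_null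
    (Set.inter_subset_inter_right _ Set.sdiff_subset) h.adm.2.1, hRf⟩
  have h1 := energy_union h.measurableSet_left h.volume_left hR hRf hD hDf disjoint_sdiff_self_left
  have h2 := interaction_union_right hR hD disjoint_sdiff_self_left hRf hDf hD hDf
  rw [Set.sdiff_union_of_subset hDA] at h1 h2
  rw [integral_neg, setIntegral_potential h.measurableSet_left h.volume_left h.measurableSet_right
    h.volume_right hDf]
  linarith

lemma setIntegral_potential_le (h : IsMinimizer P A) {D : Set E3} (hDA : D ⊆ (P ∪ A)ᶜ)
    (hD : MeasurableSet D) (hDf : volume D < ⊤) :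
    2 * ∫ x in D, potential P A x ≤ interaction D D := by
  have hdA : Disjoint A D :=
    (Set.disjoint_compl_right_iff_subset.2 Set.subset_union_right).mono_right hDA
  have hdP : Disjoint P D :=
    (Set.disjoint_compl_right_iff_subset.2 Set.subset_union_left).mono_right hDA
  have hle := h.energy_le (A ∪ D) ⟨h.measurableSet_right.union hD, by
    rw [Set.inter_union_distrib_left, hdP.inter_eq, Set.union_empty]
    exact h.adm.2.1, measure_union_lt_top h.volume_right hDf⟩
  rw [energy_union h.measurableSet_left h.volume_left h.measurableSet_right h.volume_right hD hDf
    hdA] at hle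
  rw [setIntegral_potential h.measurableSet_left h.volume_left h.measurableSet_right
    h.volume_right hDf]
  linarith

/-- The charge density of the configuration. -/
def density (P A : Set E3) (y : E3) : ℝ :=
  P.indicator (fun _ => (1:ℝ)) y - A.indicator (fun _ => (1:ℝ)) y

lemma integrable_density (h : IsMinimizer P A) : Integrable (density P A) :=
  (integrable_indicator_one h.measurableSet_left h.volume_left).sub
    (integrable_indicator_one h.measurableSet_right h.volume_right)

lemma abs_density_le (P A : Set E3) (y : E3) : |density P A y| ≤ 1 := by
  by_cases hP : y ∈ P <;> by_cases hA : y ∈ A <;> simp [density, hP, hA]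

lemma continuous_potential (h : IsMinimizer P A) : Continuous (potential P A) :=
  continuous_newtonPot h.integrable_density (abs_density_le P A)

lemma tendsto_potential (h : IsMinimizer P A) :
    Filter.Tendsto (potential P A) (Filter.cocompact E3) (nhds 0) :=
  tendsto_newtonPot h.integrable_density (abs_density_le P A)

lemma ballAvg_potential (h : IsMinimizer P A) {r : ℝ} (hr : 0 < r) (x : E3) :
    ballAvg r (potential P A) x
      = potential P A x - ∫ y, density P A y * excessKernel r x y :=
  ballAvg_newtonPot h.integrable_density (abs_density_le P A) hr x

lemma ae_notMem_of_neg (h : IsMinimizer P A) : ∀ᵐ y, potential P A y < 0 → y ∉ A := by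
  have h0 := measure_inter_pos_eq_zero h.continuous_potential.neg h.measurableSet_right
    fun D => h.setIntegral_neg_potential_le
  filter_upwards [compl_mem_ae_iff.2 h0] with y hy hneg hyA
  exact hy ⟨hyA, neg_pos.2 hneg⟩

lemma ae_mem_of_pos (h : IsMinimizer P A) : ∀ᵐ y, 0 < potential P A y → y ∈ P ∪ A := by
  have h0 := measure_inter_pos_eq_zero h.continuous_potential
    (h.measurableSet_left.union h.measurableSet_right).compl fun D => h.setIntegral_potential_le
  filter_upwards [compl_mem_ae_iff.2 h0] with y hy hpos
  by_contra hyA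
  exact hy ⟨hyA, hpos⟩

lemma ballAvg_le_of_neg (h : IsMinimizer P A) {r : ℝ} (hr : 0 < r) {x : E3}
    (hneg : ∀ y ∈ Metric.closedBall x r, potential P A y < 0) :
    ballAvg r (potential P A) x ≤ potential P A x := by
  rw [h.ballAvg_potential hr, sub_le_self_iff]
  refine integral_nonneg_of_ae ?_
  filter_upwards [h.ae_notMem_of_neg, ae_excessKernel_nonneg hr x] with y hyA hy
  by_cases hyr : y ∈ Metric.closedBall x r
  · have hd : density P A y = P.indicator (fun _ => (1:ℝ)) y := by
      simp [density, hyA (hneg y hyr)]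
    rw [hd]
    exact mul_nonneg (Set.indicator_nonneg (fun _ _ => zero_le_one) y) hy
  · simp [excessKernel_eq_zero hr hyr]

end IsMinimizer

lemma eq_of_ballAvg_le {f : E3 → ℝ} (hf : Continuous f) {r : ℝ} (hr : 0 < r) {x : E3}
    (hmin : ∀ y, f x ≤ f y) (havg : ballAvg r f x ≤ f x) :
    Set.EqOn f (fun _ => f x) (Metric.ball x r) := by
  have hg : Continuous fun y => f y - f x := by fun_prop
  have h1 : ballAvg r (fun y => f y - f x) x ≤ 0 := by
    rw [ballAvg_sub hf continuous_const, ballAvg_const]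
    linarith
  have hnn : 0 ≤ᵐ[volume.restrict (Metric.closedBall x r)] fun y => f y - f x :=
    Filter.Eventually.of_forall fun y => sub_nonneg.2 (hmin y)
  have h0 : ∫ y in Metric.closedBall x r, (f y - f x) = 0 := by
    refine le_antisymm ?_ (integral_nonneg_of_ae hnn)
    rw [ballAvg_eq_setIntegral _ hr] at h1
    have : 0 < (volume (Metric.closedBall (0:E3) 1)).toReal⁻¹ * (r ^ 3)⁻¹ := by
      have := ENNReal.toReal_pos volume_unitBall_pos.ne' volume_unitBall_ne_top
      positivity
    exact nonpos_of_mul_nonpos_right h1 this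
  rw [setIntegral_eq_zero_iff_of_nonneg_ae hnn
    (hg.continuousOn.integrableOn_compact (isCompact_closedBall _ _))] at h0
  refine Measure.eqOn_open_of_ae_eq (μ := volume) ?_ Metric.isOpen_ball hf.continuousOn
    continuousOn_const
  filter_upwards [ae_restrict_of_ae_restrict_of_subset Metric.ball_subset_closedBall h0] with y hy
  exact sub_eq_zero.1 hy

namespace IsMinimizer

variable {P A : Set E3}

lemma potential_nonneg (h : IsMinimizer P A) (x : E3) : 0 ≤ potential P A x := by
  by_contra! hx
  have hc := h.continuous_potential
  obtain ⟨a, ha⟩ := hc.exists_forall_le' x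
    ((h.tendsto_potential.eventually_const_lt hx).mono fun y hy => hy.le)
  have ha0 : potential P A a < 0 := (ha x).trans_lt hx
  have hopen : IsOpen {y | potential P A y = potential P A a} := by
    rw [Metric.isOpen_iff]
    intro y hy
    have hy : potential P A y = potential P A a := hy
    obtain ⟨r, hr, hball⟩ := Metric.nhds_basis_closedBall.mem_iff.1
      (hc.continuousAt.eventually_lt_const (hy.trans_lt ha0))
    exact ⟨r, hr, fun z hz => (eq_of_ballAvg_le hc hr (fun w => hy.trans_le (ha w))
      (h.ballAvg_le_of_neg hr fun w hw => hball hw) hz).trans hy⟩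
  have huniv := IsClopen.eq_univ ⟨isClosed_eq hc continuous_const, hopen⟩ ⟨a, rfl⟩
  have hconst : potential P A = fun _ => potential P A a :=
    funext fun y => huniv.symm.subset (Set.mem_univ y)
  have hlim := h.tendsto_potential
  rw [hconst] at hlim
  exact ha0.ne (tendsto_nhds_unique tendsto_const_nhds hlim)

lemma ballAvg_potential_eq_add (h : IsMinimizer P A) {r : ℝ} (hr : 0 < r) {x : E3}
    (hx : Metric.closedBall x r ⊆ (closure P)ᶜ) :
    ballAvg r (potential P A) x = potential P A x + ∫ y in A, excessKernel r x y := by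
  rw [h.ballAvg_potential hr, ← integral_indicator h.measurableSet_right, sub_eq_add_neg,
    ← integral_neg]
  congr 2 with y
  by_cases hyr : y ∈ Metric.closedBall x r
  · have hyP : y ∉ P := fun hyP => hx hyr (subset_closure hyP)
    by_cases hyA : y ∈ A <;> simp [density, hyP, hyA]
  · by_cases hyA : y ∈ A <;> simp [hyA, excessKernel_eq_zero hr hyr]

/-- Off the closure of the positive charge, the potential of a minimizer solves an obstacle
problem. -/
lemma obstacleSolution (h : IsMinimizer P A) :
    ObstacleSolution (potential P A) (closure P)ᶜ excessMass where
  continuous := h.continuous_potential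
  nonneg := h.potential_nonneg
  isOpen := isClosed_closure.isOpen_compl
  const_pos := excessMass_pos
  le_avg x r hr hx := by
    rw [h.ballAvg_potential_eq_add hr hx, le_add_iff_nonneg_right]
    exact integral_nonneg_of_ae (ae_restrict_of_ae (ae_excessKernel_nonneg hr x))
  avg_le x r hr hx := by
    rw [h.ballAvg_potential_eq_add hr hx, ← integral_excessKernel hr x,
      add_le_add_iff_left]
    exact setIntegral_le_integral (integrable_excessKernel hr x) (ae_excessKernel_nonneg hr x)
  avg_eq x r hr hx hpos := by
    rw [h.ballAvg_potential_eq_add hr hx, ← integral_excessKernel hr x,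
      ← integral_indicator h.measurableSet_right]
    congr 1
    refine integral_congr_ae ?_
    filter_upwards [h.ae_mem_of_pos] with y hy
    by_cases hyr : y ∈ Metric.closedBall x r
    · have hyA : y ∈ A :=
        (hy (hpos y hyr)).resolve_left fun hyP => hx hyr (subset_closure hyP)
      simp [hyA]
    · by_cases hyA : y ∈ A <;> simp [hyA, excessKernel_eq_zero hr hyr]

end IsMinimizer

/-- **Theorem 2.5** (Regularity, first part): the potential `φ` of the
minimizer is locally `C^{1,1}` outside `closure Ω⁺` (differentiable with
locally Lipschitz gradient), and the boundary of the uncharged region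
`Ω₀ = ℝ³ \ closure {φ > 0}` has locally finite `ℋ²`-measure in
`ℝ³ \ closure Ω⁺`. -/
theorem regularity_of_potential_and_free_boundary
    (Ωp : Set E3) (ho : IsOpen Ωp) (hb : Bornology.IsBounded Ωp)
    (hlip : HasLipschitzBoundary Ωp)
    (Ωm : Set E3) (hadm : Adm Ωp Ωm)
    (hmin : ∀ A, Adm Ωp A → energy Ωp Ωm ≤ energy Ωp A) :
    let φ := potential Ωp Ωm
    let Ω₀ := (closure {x | 0 < φ x})ᶜ
    (∀ x ∈ (closure Ωp)ᶜ, DifferentiableAt ℝ φ x) ∧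
    (∀ K : Set E3, IsCompact K → K ⊆ (closure Ωp)ᶜ →
      ∃ L : NNReal, LipschitzOnWith L (gradient φ) K) ∧
    (∀ K : Set E3, IsCompact K → K ⊆ (closure Ωp)ᶜ →
      μH[2] (frontier Ω₀ ∩ K) < ⊤) := by
  have h := (IsMinimizer.mk ho hb hadm hmin).obstacleSolution
  exact ⟨fun x hx => h.differentiableAt hx,
    fun K hK hKU => h.exists_lipschitzOnWith_gradient hK hKU,
    fun K hK hKU => h.hausdorffMeasure_lt_top hK hKU⟩
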